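/- arXiv:1804.02803 — 6 statements merged into one kernel-verified Lean document; each statement's English description precedes it below -/
import Mathlib

section
/- Let R be a commutative ring with 1 and let d be an integer with 2 ≤ d ≤ 25. Then every homogeneous polynomial f(X₀,X₁,X₂) ∈ R[X₀,X₁,X₂] of degree d admits a linear Pfaffian R-representation; that is, there exist 2d×2d skew-symmetric matrices A₀, A₁, A₂ with entries in R such that Pf(X₀·A₀ + X₁·A₁ + X₂·A₂) = f(X₀,X₁,X₂), where the Pfaffian is computed of the skew-symmetric matrix with entries in the polynomial ring R[X₀,X₁,X₂]. -/
/-- The Pfaffian of a `2n × 2n` skew-symmetric matrix over a commutative ring,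
defined recursively by a Laplace-type expansion along the last row:
`Pf(M) = m₁₂` for `n = 1`, and
`Pf(M) = ∑_{j=1}^{2n-1} (-1)ʲ · m_{2n,j} · Pf(M^{2n,j})` for `n ≥ 2`, where
`M^{2n,j}` is obtained from `M` by deleting the `2n`-th and `j`-th rows and columns. -/
def matrixPfaffian {R : Type*} [CommRing R] :
    (n : ℕ) → Matrix (Fin (2 * n)) (Fin (2 * n)) R → R
  | 0, _ => 1
  | n + 1, M =>
      ∑ j : Fin (2 * n + 1),
        (-1 : R) ^ ((j : ℕ) + 1) * M (Fin.last (2 * n + 1)) j.castSucc *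
          matrixPfaffian n (fun a b => M ((j.succAbove a).castSucc) ((j.succAbove b).castSucc))

open MvPolynomial Matrix

namespace PfRep

variable {S : Type*} [CommRing S]

/-- The Pfaffian commutes with ring homomorphisms. -/
theorem pf_map {T : Type*} [CommRing T] (φ : S →+* T) (n : ℕ)
    (M : Matrix (Fin (2 * n)) (Fin (2 * n)) S) :
    φ (matrixPfaffian n M) = matrixPfaffian n (fun a b => φ (M a b)) := by
  induction n with
  | zero => simp [matrixPfaffian]
  | succ n ih =>
    simp only [matrixPfaffian, map_sum, map_mul, map_pow, map_neg, map_one]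
    refine Finset.sum_congr rfl fun j _ => ?_
    exact congrArg _ (ih _)

/-- The Pfaffian of a matrix of linear forms is homogeneous. -/
theorem pf_homog {R : Type*} [CommRing R] (n : ℕ)
    (M : Matrix (Fin (2 * n)) (Fin (2 * n)) (MvPolynomial (Fin 3) R))
    (h : ∀ a b, (M a b).IsHomogeneous 1) : (matrixPfaffian n M).IsHomogeneous n := by
  induction n with
  | zero => simpa [matrixPfaffian] using isHomogeneous_one (Fin 3) R
  | succ n ih =>
    simp only [matrixPfaffian]
    refine IsHomogeneous.sum _ _ _ fun j _ => ?_
    have h1 : ((-1 : MvPolynomial (Fin 3) R) ^ ((j : ℕ) + 1)).IsHomogeneous 0 := by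
      have := ((isHomogeneous_one (Fin 3) R).neg).pow ((j : ℕ) + 1)
      simpa using this
    have h2 := (h1.mul (h (Fin.last (2 * n + 1)) j.castSucc)).mul
      (ih (fun a b => M ((j.succAbove a).castSucc) ((j.succAbove b).castSucc)) (fun a b => h _ _))
    have e : 0 + 1 + n = n + 1 := by omega
    rw [e] at h2
    exact h2

/-- Pfaffian of a tridiagonal matrix. -/
theorem pf_tri (n : ℕ) (L : ℕ → ℕ → S) (h : ∀ a b, b + 2 ≤ a → L a b = 0) :
    matrixPfaffian n (fun a b : Fin (2 * n) => L a b) =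
      ∏ a ∈ Finset.range n, (- L (2 * a + 1) (2 * a)) := by
  induction n with
  | zero => simp [matrixPfaffian]
  | succ n ih =>
    rw [Finset.prod_range_succ, ← ih]
    simp only [matrixPfaffian]
    rw [Fin.sum_univ_castSucc, Finset.sum_eq_zero]
    · simp [pow_succ, pow_mul]
      ring
    · intro j _
      have : L (2 * n + 1) j = 0 := h _ _ (by have := j.2; omega)
      simp [this]

/-- Vertices: `inl a` are the rows, `inr b` the columns of the band matrix. -/
def isR : ℕ ⊕ ℕ → ℕ
  | Sum.inl _ => 0
  | Sum.inr _ => 1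

/-- The band matrix. -/
def band (x y z : S) (a b : ℕ) : S :=
  if a = b then x else if a = b + 1 then -y else if a = b + 2 then z else 0

/-- The skew-symmetric block matrix with blocks `P`, band, `0`. -/
def E (x y z : S) (P : ℕ → ℕ → S) : ℕ ⊕ ℕ → ℕ ⊕ ℕ → S
  | Sum.inl a, Sum.inl b => P a b
  | Sum.inl a, Sum.inr b => band x y z a b
  | Sum.inr b, Sum.inl a => - band x y z a b
  | Sum.inr _, Sum.inr _ => 0

theorem count_split (n : ℕ) (u : Fin (2 * n + 2) → ℕ) (j : Fin (2 * n + 1)) :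
    ∑ a, u a = u (Fin.last (2 * n + 1)) + u j.castSucc +
      ∑ a : Fin (2 * n), u ((j.succAbove a).castSucc) := by
  rw [Fin.sum_univ_castSucc, Fin.sum_univ_succAbove _ j]
  ring

theorem isR_inl (a : ℕ) : isR (Sum.inl a) = 0 := rfl

theorem isR_inr (a : ℕ) : isR (Sum.inr a) = 1 := rfl

theorem pf_zero (x y z : S) (P : ℕ → ℕ → S) (n : ℕ) (u : Fin (2 * n) → ℕ ⊕ ℕ)
    (h : n < ∑ a, isR (u a)) :
    matrixPfaffian n (fun a b => E x y z P (u a) (u b)) = 0 := by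
  induction n with
  | zero => simp at h
  | succ n ih =>
    simp only [matrixPfaffian]
    refine Finset.sum_eq_zero fun j _ => ?_
    have hc := count_split n (fun a => isR (u a)) j
    have h' : n + 1 < isR (u (Fin.last (2 * n + 1))) + isR (u j.castSucc) +
      ∑ a : Fin (2 * n), isR (u ((j.succAbove a).castSucc)) := by
      rw [← hc]; exact h
    by_cases hr : isR (u (Fin.last (2 * n + 1))) + isR (u j.castSucc) ≤ 1
    · rw [ih (fun a => u ((j.succAbove a).castSucc)) (by omega), mul_zero]
    · have : E x y z P (u (Fin.last (2 * n + 1))) (u j.castSucc) = 0 := by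
        revert hr
        rcases u (Fin.last (2 * n + 1)) with a | a <;> rcases u j.castSucc with b | b <;>
          simp [isR, E]
      rw [this]; simp

theorem pf_indep (x y z : S) (P P' : ℕ → ℕ → S) (n : ℕ) (u : Fin (2 * n) → ℕ ⊕ ℕ)
    (h : ∑ a, isR (u a) = n) :
    matrixPfaffian n (fun a b => E x y z P (u a) (u b)) =
      matrixPfaffian n (fun a b => E x y z P' (u a) (u b)) := by
  induction n with
  | zero => simp [matrixPfaffian]
  | succ n ih =>
    simp only [matrixPfaffian]
    refine Finset.sum_congr rfl fun j _ => ?_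
    have hc := count_split n (fun a => isR (u a)) j
    have h' : isR (u (Fin.last (2 * n + 1))) + isR (u j.castSucc) +
      ∑ a : Fin (2 * n), isR (u ((j.succAbove a).castSucc)) = n + 1 := by
      rw [← hc]; exact h
    rcases hl : u (Fin.last (2 * n + 1)) with a | a <;> rcases hj : u j.castSucc with b | b <;>
      simp only [hl, hj, isR_inl, isR_inr] at h'
    · rw [pf_zero x y z P n (fun a => u ((j.succAbove a).castSucc)) (by omega),
        pf_zero x y z P' n (fun a => u ((j.succAbove a).castSucc)) (by omega)]
      simp
    · rw [ih (fun a => u ((j.succAbove a).castSucc)) (by omega)]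
      simp [E]
    · rw [ih (fun a => u ((j.succAbove a).castSucc)) (by omega)]
      simp [E]
    · simp [E]

/-- Interleaved vertex order. -/
def w (t : ℕ) : ℕ ⊕ ℕ := if t % 2 = 0 then Sum.inl (t / 2) else Sum.inr (t / 2)

/-- Vertex order, with the last vertex replaced. -/
def v (n t : ℕ) : ℕ ⊕ ℕ := if t = 2 * n + 1 then Sum.inl (n + 1) else w t

def skip (j a : ℕ) : ℕ := if a < j then a else a + 1

theorem succAbove_val {m : ℕ} (j : Fin (m + 1)) (a : Fin m) :
    ((j.succAbove a : Fin (m + 1)) : ℕ) = skip j a := by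
  unfold skip Fin.succAbove
  simp only [Fin.lt_def, Fin.val_castSucc]
  split_ifs <;> simp

theorem w_even (b : ℕ) : w (2 * b) = Sum.inl b := by simp [w]

theorem w_odd (b : ℕ) : w (2 * b + 1) = Sum.inr b := by
  have h1 : (2 * b + 1) % 2 = 1 := by omega
  have h2 : (2 * b + 1) / 2 = b := by omega
  simp [w, h1, h2]

theorem count_w (n : ℕ) : ∑ a ∈ Finset.range (2 * n + 1), isR (w a) = n := by
  induction n with
  | zero => simp [w, isR]
  | succ n ih =>
    have e : 2 * (n + 1) + 1 = 2 * n + 1 + 1 + 1 := by ring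
    rw [e, Finset.sum_range_succ, Finset.sum_range_succ, ih, w_odd,
      show 2 * n + 1 + 1 = 2 * (n + 1) by ring, w_even]
    simp [isR]

/-- The main matrix. -/
def mat (x y z : S) (P : ℕ → ℕ → S) (n : ℕ) : Matrix (Fin (2 * (n + 1))) (Fin (2 * (n + 1))) S :=
  fun a b => E x y z P (v n a) (v n b)

/-- The minors. -/
def K (x y z : S) (P : ℕ → ℕ → S) (n j : ℕ) : Matrix (Fin (2 * n)) (Fin (2 * n)) S :=
  fun a b => E x y z P (w (skip j a)) (w (skip j b))

theorem K_indep (x y z : S) (P P' : ℕ → ℕ → S) (n b : ℕ) (hb : b ≤ n) :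
    matrixPfaffian n (K x y z P n (2 * b)) = matrixPfaffian n (K x y z P' n (2 * b)) := by
  refine pf_indep x y z P P' n (fun a => w (skip (2 * b) a)) ?_
  have h := count_w n
  rw [Finset.sum_range (fun a => isR (w a)),
    Fin.sum_univ_succAbove _ (⟨2 * b, by omega⟩ : Fin (2 * n + 1))] at h
  simp only [succAbove_val, w_even, isR, zero_add] at h
  exact h

theorem K_tri (x y : S) (n b : ℕ) (hb : b ≤ n) :
    matrixPfaffian n (K x y 0 (fun _ _ => 0) n (2 * b)) = x ^ b * y ^ (n - b) := by
  have h := pf_tri n (fun a c => E x y 0 (fun _ _ => 0) (w (skip (2 * b) a)) (w (skip (2 * b) c))) ?_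
  · refine h.trans ?_
    obtain ⟨m, rfl⟩ := Nat.exists_eq_add_of_le hb
    rw [Finset.prod_range_add, Nat.add_sub_cancel_left]
    congr 1
    · rw [Finset.prod_congr rfl (g := fun _ => x)]
      · simp
      · intro a ha
        have ha := Finset.mem_range.1 ha
        have h1 : skip (2 * b) (2 * a + 1) = 2 * a + 1 := by unfold skip; split_ifs <;> omega
        have h2 : skip (2 * b) (2 * a) = 2 * a := by unfold skip; split_ifs <;> omega
        simp [h1, h2, w_odd, w_even, E, band]
    · rw [Finset.prod_congr rfl (g := fun _ => y)]
      · simp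
      · intro a ha
        have h1 : skip (2 * b) (2 * (b + a) + 1) = 2 * (b + a + 1) := by
          unfold skip; split_ifs <;> omega
        have h2 : skip (2 * b) (2 * (b + a)) = 2 * (b + a) + 1 := by
          unfold skip; split_ifs <;> omega
        simp only [h1, h2, w_odd, w_even, E, band]
        simp
  · intro a c hac
    have h1 : skip (2 * b) c + 2 ≤ skip (2 * b) a := by unfold skip; split_ifs <;> omega
    generalize skip (2 * b) c = c' at h1
    generalize skip (2 * b) a = a' at h1
    simp only [w]
    split_ifs <;> simp only [E, band]
    · split_ifs <;> first | rfl | omega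
    · split_ifs <;> first | omega | simp

theorem sum_parity (n : ℕ) (g : ℕ → S) : ∑ j ∈ Finset.range (2 * n + 1), g j =
    ∑ b ∈ Finset.range (n + 1), g (2 * b) + ∑ b ∈ Finset.range n, g (2 * b + 1) := by
  induction n with
  | zero => simp
  | succ n ih =>
    have e : 2 * (n + 1) + 1 = 2 * n + 1 + 1 + 1 := by ring
    rw [e, Finset.sum_range_succ, Finset.sum_range_succ, ih, Finset.sum_range_succ _ (n + 1),
      Finset.sum_range_succ (fun b => g (2 * b + 1)) n, show 2 * n + 1 + 1 = 2 * (n + 1) by ring]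
    ring

theorem mat_step (x y z : S) (P : ℕ → ℕ → S) (n : ℕ) :
    matrixPfaffian (n + 2) (mat x y z P (n + 1)) =
      ∑ b ∈ Finset.range (n + 2), (- P (n + 2) b) * matrixPfaffian (n + 1) (K x y z P (n + 1) (2 * b))
      + z * matrixPfaffian (n + 1) (mat x y z P n) := by
  have h : matrixPfaffian (n + 2) (mat x y z P (n + 1)) =
      ∑ j ∈ Finset.range (2 * (n + 1) + 1), (-1 : S) ^ (j + 1) *
        E x y z P (Sum.inl (n + 2)) (w j) * matrixPfaffian (n + 1) (K x y z P (n + 1) j) := by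
    rw [Finset.sum_range]
    rw [matrixPfaffian]
    refine Finset.sum_congr rfl fun j _ => ?_
    have hv : ∀ i : Fin (2 * (n + 1) + 1), v (n + 1) (i : ℕ) = w i := by
      intro i
      have := i.2
      unfold v
      rw [if_neg (by omega)]
    congr 1
    · simp only [mat, Fin.val_last, Fin.val_castSucc, hv]
      simp [v]
    · congr 1
      funext a b
      simp only [mat, K, Fin.val_castSucc]
      rw [hv, hv, succAbove_val, succAbove_val]
  rw [h, sum_parity]
  congr 1
  · refine Finset.sum_congr rfl fun b _ => ?_
    simp [w_even, E, pow_succ, pow_mul]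
  · rw [Finset.sum_range_succ, Finset.sum_eq_zero]
    · have hK : K x y z P (n + 1) (2 * n + 1) = mat x y z P n := by
        funext a b
        have key : ∀ a : Fin (2 * (n + 1)), w (skip (2 * n + 1) a) = v n a := by
          intro a
          have := a.2
          unfold skip v
          split_ifs
          · omega
          · rfl
          · rw [show (a : ℕ) + 1 = 2 * (n + 1) by omega, w_even]
          · omega
        simp only [K, mat, key]
      rw [hK, w_odd]
      simp [E, band, pow_succ, pow_mul]
    · intro b hb
      have := Finset.mem_range.1 hb
      rw [w_odd]
      simp only [E, band]
      rw [if_neg (by omega), if_neg (by omega), if_neg (by omega)]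
      simp

theorem mat_congr (x y z : S) (P P' : ℕ → ℕ → S) (n : ℕ)
    (h : ∀ a b, a ≤ n + 1 → b ≤ n + 1 → P a b = P' a b) : mat x y z P n = mat x y z P' n := by
  have hv : ∀ (a : Fin (2 * (n + 1))) c, v n a = Sum.inl c → c ≤ n + 1 := by
    intro a c hc
    have := a.2
    unfold v w at hc
    split_ifs at hc
    · cases hc; omega
    · cases hc; omega
  funext a b
  unfold mat
  rcases ha : v n a with c | c <;> rcases hb : v n b with e | e <;> simp only [E]
  exact h _ _ (hv a c ha) (hv b e hb)

variable {R : Type*} [CommRing R]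

theorem E_homog (P : ℕ → ℕ → MvPolynomial (Fin 3) R) (hP : ∀ a b, (P a b).IsHomogeneous 1)
    (s t : ℕ ⊕ ℕ) : (E (X 0) (X 1) (X 2) P s t).IsHomogeneous 1 := by
  have hb : ∀ a b, (band (X 0 : MvPolynomial (Fin 3) R) (X 1) (X 2) a b).IsHomogeneous 1 := by
    intro a b
    unfold band
    split_ifs
    · exact isHomogeneous_X R 0
    · exact (isHomogeneous_X R 1).neg
    · exact isHomogeneous_X R 2
    · exact isHomogeneous_zero _ _ _
  rcases s with a | a <;> rcases t with b | b <;> simp only [E]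
  · exact hP a b
  · exact hb a b
  · exact (hb b a).neg
  · exact isHomogeneous_zero _ _ _

theorem decomp (n : ℕ) (f : MvPolynomial (Fin 3) R) (hf : f.IsHomogeneous (n + 1)) :
    ∃ l : ℕ → MvPolynomial (Fin 3) R, (∀ i, (l i).IsHomogeneous 1) ∧
      f - ∑ b ∈ Finset.range (n + 1), l b * (X 0 ^ b * X 1 ^ (n - b)) ∈
        Ideal.span {(X 2 : MvPolynomial (Fin 3) R)} := by
  rw [f.as_sum]
  refine Finset.sum_induction _ (fun f => ∃ l : ℕ → MvPolynomial (Fin 3) R,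
    (∀ i, (l i).IsHomogeneous 1) ∧
      f - ∑ b ∈ Finset.range (n + 1), l b * (X 0 ^ b * X 1 ^ (n - b)) ∈
        Ideal.span {(X 2 : MvPolynomial (Fin 3) R)}) ?_ ?_ ?_
  · rintro f g ⟨l, hl, h⟩ ⟨l', hl', h'⟩
    refine ⟨fun i => l i + l' i, fun i => (hl i).add (hl' i), ?_⟩
    convert Ideal.add_mem _ h h' using 1
    simp only [add_mul, Finset.sum_add_distrib]
    ring
  · exact ⟨fun _ => 0, fun _ => isHomogeneous_zero _ _ _, by simp⟩
  · intro m hm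
    have hdeg : m 0 + m 1 + m 2 = n + 1 := by
      have := hf (mem_support_iff.1 hm)
      rw [Finsupp.weight_apply, Finsupp.sum_fintype _ _ (by simp)] at this
      simpa [Fin.sum_univ_three] using this
    have hmon : monomial m (coeff m f) =
        C (coeff m f) * (X 0 ^ m 0 * X 1 ^ m 1 * X 2 ^ m 2) := by
      rw [monomial_eq, Finsupp.prod_fintype _ _ (by simp)]
      simp [Fin.prod_univ_three]
    have single : ∀ (k : ℕ) (c : MvPolynomial (Fin 3) R), k < n + 1 → c.IsHomogeneous 1 →
        monomial m (coeff m f) = c * (X 0 ^ k * X 1 ^ (n - k)) →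
        ∃ l : ℕ → MvPolynomial (Fin 3) R, (∀ i, (l i).IsHomogeneous 1) ∧
        monomial m (coeff m f) - ∑ b ∈ Finset.range (n + 1), l b * (X 0 ^ b * X 1 ^ (n - b)) ∈
        Ideal.span {(X 2 : MvPolynomial (Fin 3) R)} := by
      intro k c hk hc he
      refine ⟨fun i => if i = k then c else 0, fun i => ?_, ?_⟩
      · dsimp only
        split_ifs
        · exact hc
        · exact isHomogeneous_zero _ _ _
      · rw [Finset.sum_eq_single k]
        · simp only [if_true]; rw [he, sub_self]; exact Ideal.zero_mem _
        · intro b _ hb; simp only [if_neg hb, zero_mul]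
        · intro h; exact absurd (Finset.mem_range.2 hk) h
    by_cases h2 : m 2 = 0
    · by_cases h0 : m 0 = 0
      · refine single 0 (C (coeff m f) * X 1) (by omega) ?_ ?_
        · simpa using (isHomogeneous_C (Fin 3) (coeff m f)).mul (isHomogeneous_X R (1 : Fin 3))
        · rw [hmon, h2, h0, show m 1 = n + 1 by omega]
          simp only [pow_zero, Nat.sub_zero]
          ring
      · obtain ⟨k, hk⟩ := Nat.exists_eq_succ_of_ne_zero h0
        refine single k (C (coeff m f) * X 0) (by omega) ?_ ?_
        · simpa using (isHomogeneous_C (Fin 3) (coeff m f)).mul (isHomogeneous_X R (0 : Fin 3))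
        · rw [hmon, h2, hk, show m 1 = n - k by omega, Nat.succ_eq_add_one]
          ring
    · refine ⟨fun _ => 0, fun _ => isHomogeneous_zero _ _ _, ?_⟩
      obtain ⟨k, hk⟩ := Nat.exists_eq_succ_of_ne_zero h2
      rw [Ideal.mem_span_singleton]
      refine ⟨C (coeff m f) * (X 0 ^ m 0 * X 1 ^ m 1 * X 2 ^ k), ?_⟩
      rw [hmon, hk, Nat.succ_eq_add_one]
      simp only [zero_mul, Finset.sum_const_zero, sub_zero]
      ring

theorem homog_cancel (n : ℕ) (g : MvPolynomial (Fin 3) R)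
    (h : (X 2 * g : MvPolynomial (Fin 3) R).IsHomogeneous (n + 1)) : g.IsHomogeneous n := by
  intro m hm
  have := @h (Finsupp.single 2 1 + m) (by rwa [coeff_X_mul])
  rw [map_add, Finsupp.weight_single] at this
  simp only [Pi.one_apply, smul_eq_mul, mul_one] at this
  omega

theorem main (n : ℕ) (f : MvPolynomial (Fin 3) R) (hf : f.IsHomogeneous (n + 1)) :
    ∃ P : ℕ → ℕ → MvPolynomial (Fin 3) R, (∀ a b, (P a b).IsHomogeneous 1) ∧
      (∀ a b, P a b = - P b a) ∧
      matrixPfaffian (n + 1) (mat (X 0) (X 1) (X 2) P n) = f := by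
  induction n generalizing f with
  | zero =>
    refine ⟨fun a b => if a < b then f else if b < a then -f else 0, ?_, ?_, ?_⟩
    · intro a b
      dsimp only
      split_ifs
      · exact hf
      · exact hf.neg
      · exact isHomogeneous_zero _ _ _
    · intro a b
      dsimp only
      split_ifs <;> first | omega | simp
    · simp [matrixPfaffian, mat, v, w, E]
  | succ n ih =>
    obtain ⟨l, hl, hdec⟩ := decomp (n + 1) f hf
    let k : ℕ → MvPolynomial (Fin 3) R := fun b =>
      matrixPfaffian (n + 1) (K (X 0) (X 1) (X 2) (fun _ _ => 0) (n + 1) (2 * b))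
    have hk : ∀ b, (k b).IsHomogeneous (n + 1) := fun b =>
      pf_homog _ _ fun _ _ => E_homog _ (fun _ _ => isHomogeneous_zero _ _ _) _ _
    have hkm : ∀ b ≤ n + 1, k b - X 0 ^ b * X 1 ^ (n + 1 - b) ∈
        Ideal.span {(X 2 : MvPolynomial (Fin 3) R)} := by
      intro b hb
      rw [← Ideal.Quotient.eq]
      simp only [k]
      rw [pf_map]
      set φ := Ideal.Quotient.mk (Ideal.span {(X 2 : MvPolynomial (Fin 3) R)})
      have hz : φ (X 2) = 0 := Ideal.Quotient.eq_zero_iff_mem.2 (Ideal.subset_span rfl)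
      rw [map_mul, map_pow, map_pow, ← K_tri (φ (X 0)) (φ (X 1)) (n + 1) b hb]
      congr 1
      funext s t
      have hE : ∀ s t, φ (E (X 0) (X 1) (X 2) (fun _ _ => 0) s t) =
          E (φ (X 0)) (φ (X 1)) 0 (fun _ _ => 0) s t := by
        rintro (a | a) (b | b) <;> simp only [E, band, map_neg, map_zero] <;>
          split_ifs <;> simp [hz]
      exact hE _ _
    have hmem : f - ∑ b ∈ Finset.range (n + 2), l b * k b ∈
        Ideal.span {(X 2 : MvPolynomial (Fin 3) R)} := by
      have h2 : ∑ b ∈ Finset.range (n + 2), l b * (k b - X 0 ^ b * X 1 ^ (n + 1 - b)) ∈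
          Ideal.span {(X 2 : MvPolynomial (Fin 3) R)} :=
        Ideal.sum_mem _ fun b hb => Ideal.mul_mem_left _ _
          (hkm b (by have := Finset.mem_range.1 hb; omega))
      convert Ideal.sub_mem _ hdec h2 using 1
      simp only [mul_sub, Finset.sum_sub_distrib]
      ring
    obtain ⟨g, hg⟩ := Ideal.mem_span_singleton.1 hmem
    have hgh : g.IsHomogeneous (n + 1) := by
      apply homog_cancel
      rw [← hg]
      refine hf.sub (IsHomogeneous.sum _ _ _ fun b _ => ?_)
      have := (hl b).mul (hk b)
      rwa [show 1 + (n + 1) = n + 1 + 1 by omega] at this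
    obtain ⟨P, hP1, hP2, hP3⟩ := ih g hgh
    let Q : ℕ → ℕ → MvPolynomial (Fin 3) R := fun a b =>
      if a = n + 2 then (if b = n + 2 then 0 else - l b) else if b = n + 2 then l a else P a b
    refine ⟨Q, ?_, ?_, ?_⟩
    · intro a b
      simp only [Q]
      split_ifs
      · exact isHomogeneous_zero _ _ _
      · exact (hl b).neg
      · exact hl a
      · exact hP1 a b
    · intro a b
      simp only [Q]
      split_ifs
      · simp
      · rfl
      · simp
      · exact hP2 a b
    · rw [mat_step, mat_congr _ _ _ Q P n, hP3, ← hg, Finset.sum_congr rfl (g := fun b => l b * k b)]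
      · ring
      · intro b hb
        have hb := Finset.mem_range.1 hb
        rw [K_indep _ _ _ Q (fun _ _ => 0) (n + 1) b (by omega)]
        simp only [Q, k]
        rw [if_pos trivial, if_neg (by omega), neg_neg]
      · intro a b ha hb
        simp only [Q]
        rw [if_neg (by omega), if_neg (by omega)]

theorem linear_eq (p : MvPolynomial (Fin 3) R) (hp : p.IsHomogeneous 1) :
    X 0 * C (coeff (Finsupp.single 0 1) p) + X 1 * C (coeff (Finsupp.single 1 1) p) +
      X 2 * C (coeff (Finsupp.single 2 1) p) = p := by
  rw [← mem_homogeneousSubmodule, homogeneousSubmodule_one_eq_span_X] at hp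
  induction hp using Submodule.span_induction with
  | mem q hq =>
    obtain ⟨i, rfl⟩ := hq
    fin_cases i <;> simp [coeff_X, Finsupp.single_left_inj]
  | zero => simp
  | add p q _ _ h1 h2 =>
    conv_rhs => rw [← h1, ← h2]
    simp only [coeff_add, C_add]
    ring
  | smul r p _ h =>
    conv_rhs => rw [← h]
    simp only [smul_eq_C_mul, coeff_C_mul, C_mul]
    ring

end PfRep

/-- Every homogeneous polynomial `f ∈ R[X₀,X₁,X₂]` of degree `d`, `2 ≤ d ≤ 25`,
admits a linear Pfaffian `R`-representation. -/
theorem every_ternary_form_of_degree_le_25_admits_linear_pfaffian_representation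
    {R : Type*} [CommRing R] (d : ℕ) (hd2 : 2 ≤ d) (hd25 : d ≤ 25)
    (f : MvPolynomial (Fin 3) R) (hf : f.IsHomogeneous d) :
    ∃ A₀ A₁ A₂ : Matrix (Fin (2 * d)) (Fin (2 * d)) R,
      A₀ᵀ = -A₀ ∧ A₁ᵀ = -A₁ ∧ A₂ᵀ = -A₂ ∧
      matrixPfaffian d
        (((X 0 : MvPolynomial (Fin 3) R) • A₀.map C + (X 1 : MvPolynomial (Fin 3) R) • A₁.map C +
          (X 2 : MvPolynomial (Fin 3) R) • A₂.map C)) = f := by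
  obtain ⟨n, rfl⟩ : ∃ n, d = n + 1 := ⟨d - 1, by omega⟩
  obtain ⟨P, hP1, hP2, hP3⟩ := PfRep.main n f hf
  let M := PfRep.mat (X 0 : MvPolynomial (Fin 3) R) (X 1) (X 2) P n
  have hM : ∀ a b, (M a b).IsHomogeneous 1 := fun a b => PfRep.E_homog P hP1 _ _
  have hskew : ∀ a b, M b a = - M a b := by
    intro a b
    simp only [M, PfRep.mat]
    rcases PfRep.v n a with s | s <;> rcases PfRep.v n b with t | t <;> simp only [PfRep.E]
    · exact hP2 t s
    · simp
    · simp
  have hA : ∀ k : Fin 3, (Matrix.of fun a b => coeff (Finsupp.single k 1) (M a b))ᵀ =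
      - (Matrix.of fun a b => coeff (Finsupp.single k 1) (M a b)) := by
    intro k
    ext a b
    simp [hskew a b]
  refine ⟨_, _, _, hA 0, hA 1, hA 2, ?_⟩
  rw [← hP3]
  congr 1
  ext1 a b
  simpa using PfRep.linear_eq (M a b) (hM a b)
end

section
/- Let R be a commutative ring with 1 and let d be an integer with 2 ≤ d ≤ 25. Then for every homogeneous polynomial f(X₀,X₁,X₂) ∈ R[X₀,X₁,X₂] of degree d there exist 2d×2d skew-symmetric matrices A₀, A₁, A₂ with entries in R such that det(X₀·A₀ + X₁·A₁ + X₂·A₂) = f(X₀,X₁,X₂)², where the determinant is taken of the matrix with entries in the polynomial ring R[X₀,X₁,X₂]. -/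
open MvPolynomial Matrix

section Aux

/-- Determinant of the reduced block matrix. -/
theorem aux_det_blocks {S p n : Type*} [CommRing S] [Fintype p] [DecidableEq p] [Fintype n]
    [DecidableEq n] (E : Matrix p p S) (F : Matrix p n S) (F' : Matrix n p S) (H : Matrix n n S)
    (B : Matrix n n S) :
    (fromBlocks (fromBlocks E F F' H) (fromRows 0 B) (fromCols 0 (-Bᵀ)) 0).det
      = E.det * B.det ^ 2 := by
  let U : Matrix ((p ⊕ n) ⊕ n) ((p ⊕ n) ⊕ n) S := fromBlocks 1 (fromRows 0 (-1)) 0 1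
  let V : Matrix ((p ⊕ n) ⊕ n) ((p ⊕ n) ⊕ n) S := fromBlocks 1 0 (fromCols 0 1) 1
  have hU : U.det = 1 := by simp [U]
  have hV : V.det = 1 := by simp [V]
  have key : fromBlocks (fromBlocks E F F' H) (fromRows 0 B) (fromCols 0 (-Bᵀ)) 0 * U * V * U
      = fromBlocks (fromBlocks E 0 F' B) (fromRows (-F) (-H)) 0 Bᵀ := by
    simp only [U, V, fromBlocks_multiply]
    ext i j
    rcases i with (i | i) | i <;> rcases j with (j | j) | j <;>
      simp [Matrix.mul_apply, Fintype.sum_sum_type, one_apply]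
  have h := congrArg det key
  rw [det_mul, det_mul, det_mul, hU, hV, det_fromBlocks_zero₂₁, det_fromBlocks_zero₁₂,
    det_transpose] at h
  rw [mul_one, mul_one, mul_one] at h
  rw [h]; ring

/-- The reduction of the determinant by a congruence. -/
theorem aux_det_reduce {S p n : Type*} [CommRing S] [Fintype p] [DecidableEq p] [Fintype n]
    [DecidableEq n] (A : Matrix (p ⊕ n) (p ⊕ n) S) (B0 : Matrix p n S) (B1 : Matrix n n S)
    (t : S) (K : Matrix p n S)
    (hN : fromCols (t • (1 : Matrix p p S)) K * fromRows B0 B1 = 0) :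
    (fromBlocks A (fromRows B0 B1) (-(fromRows B0 B1)ᵀ) 0).det * (t ^ Fintype.card p) ^ 2
      = (fromCols (t • (1 : Matrix p p S)) K * A * (fromCols (t • (1 : Matrix p p S)) K)ᵀ).det
        * B1.det ^ 2 := by
  let N : Matrix p (p ⊕ n) S := fromCols (t • (1 : Matrix p p S)) K
  let P : Matrix n (p ⊕ n) S := fromCols 0 1
  let G : Matrix (p ⊕ n) (p ⊕ n) S := fromRows N P
  have hG : G.det = t ^ Fintype.card p := by
    have : G = fromBlocks (t • 1) K 0 1 := by
      ext i j
      rcases i with i | i <;> rcases j with j | j <;> simp [G, N, P]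
    rw [this, det_fromBlocks_zero₂₁]
    simp [det_smul]
  have hGB : G * fromRows B0 B1 = fromRows 0 B1 := by
    rw [fromRows_mul, hN]
    simp [P, fromCols_mul_fromRows]
  have hGA : G * A * Gᵀ
      = fromBlocks (N * A * Nᵀ) (N * A * Pᵀ) (P * A * Nᵀ) (P * A * Pᵀ) := by
    simp only [G, fromRows_mul, transpose_fromRows, mul_fromCols]
    ext i j
    rcases i with i | i <;> rcases j with j | j <;> simp
  have key : fromBlocks G 0 0 (1 : Matrix n n S) *
      fromBlocks A (fromRows B0 B1) (-(fromRows B0 B1)ᵀ) 0 *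
      fromBlocks Gᵀ 0 0 (1 : Matrix n n S) =
      fromBlocks (fromBlocks (N * A * Nᵀ) (N * A * Pᵀ) (P * A * Nᵀ) (P * A * Pᵀ))
        (fromRows 0 B1) (fromCols 0 (-B1ᵀ)) 0 := by
    have h2 : -(fromRows B0 B1)ᵀ * Gᵀ = fromCols 0 (-B1ᵀ) := by
      rw [Matrix.neg_mul, ← transpose_mul, hGB, transpose_fromRows]
      ext i j
      rcases j with j | j <;> simp
    simp only [fromBlocks_multiply, Matrix.zero_mul, Matrix.mul_zero, add_zero, zero_add,
      Matrix.one_mul, Matrix.mul_one, hGB, hGA, h2]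
  have h := congrArg det key
  rw [det_mul, det_mul, det_fromBlocks_zero₂₁, det_fromBlocks_zero₂₁, aux_det_blocks,
    det_transpose, hG, det_one] at h
  rw [← h]; ring

/-- The two-term recurrence. -/
def auxRs {S : Type*} [CommRing S] (y w a b : S) : ℕ → S
  | 0 => a
  | 1 => b
  | n + 2 => -y * auxRs y w a b (n + 1) - w * auxRs y w a b n

theorem auxRs_wronskian_one {S : Type*} [CommRing S] (y w : S) (i : ℕ) :
    auxRs y w 1 0 i * auxRs y w 0 1 (i + 1) - auxRs y w 0 1 i * auxRs y w 1 0 (i + 1) = w ^ i := by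
  induction i with
  | zero => simp [auxRs]
  | succ i ih =>
    rw [pow_succ, ← ih]
    simp only [auxRs]
    ring

theorem auxRs_wronskian {S : Type*} [CommRing S] (y w : S) (i m : ℕ) :
    auxRs y w 1 0 i * auxRs y w 0 1 (i + m) - auxRs y w 0 1 i * auxRs y w 1 0 (i + m)
      = w ^ i * auxRs y w 0 1 m := by
  induction m using Nat.twoStepInduction with
  | zero => simp only [auxRs, add_zero]; ring
  | one => rw [auxRs_wronskian_one]; simp [auxRs]
  | more m h1 h2 =>
    have e1 : i + (m + 2) = i + m + 2 := by ring
    have e2 : i + (m + 1) = i + m + 1 := by ring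
    rw [e2] at h2
    rw [e1]
    simp only [auxRs]
    linear_combination (-y) * h2 - w * h1

/-- The row index as a natural number. -/
def auxIdx {n : ℕ} : Fin 2 ⊕ Fin n → ℕ := Sum.elim (fun i => i) (fun j => j + 2)

theorem auxIdx_sum {S : Type*} [CommRing S] {n : ℕ} (g : ℕ → S) :
    ∑ k : Fin 2 ⊕ Fin n, g (auxIdx k) = ∑ k ∈ Finset.range (n + 2), g k := by
  rw [Fintype.sum_sum_type, Finset.sum_range_add g n 2 |> fun _ => (by
    rw [add_comm n 2, Finset.sum_range_add, Finset.sum_range, Finset.sum_range] :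
      ∑ k ∈ Finset.range (n + 2), g k = ∑ k : Fin 2, g k + ∑ k : Fin n, g (2 + k))]
  simp [auxIdx, add_comm]

theorem auxIdx_surj {n i : ℕ} (hi : i < n + 2) : ∃ k : Fin 2 ⊕ Fin n, auxIdx k = i := by
  by_cases h : i < 2
  · exact ⟨Sum.inl ⟨i, h⟩, rfl⟩
  · exact ⟨Sum.inr ⟨i - 2, by omega⟩, by simp [auxIdx]; omega⟩

/-- The shift matrices. -/
def auxB (R : Type*) [CommRing R] (n v : ℕ) : Matrix (Fin 2 ⊕ Fin n) (Fin n) R :=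
  Matrix.of fun k j => if auxIdx k = (j : ℕ) + v then 1 else 0

/-- The two kernel sequences. -/
def auxU {S : Type*} [CommRing S] (x y z : S) (n : ℕ) (r : Fin 2) (i : ℕ) : S :=
  if r = 0 then z ^ (n + 1 - i) * auxRs y (x * z) 1 0 i
  else z ^ (n + 2 - i) * auxRs y (x * z) 0 1 i

theorem auxU_rec {S : Type*} [CommRing S] (x y z : S) (n : ℕ) (r : Fin 2) (j : ℕ) (hj : j < n) :
    auxU x y z n r j * x + auxU x y z n r (j + 1) * y + auxU x y z n r (j + 2) * z = 0 := by
  obtain ⟨k, rfl⟩ : ∃ k, n = j + 1 + k := ⟨n - (j + 1), by omega⟩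
  have a1 : j + 1 + k + 1 - j = k + 2 := by omega
  have a2 : j + 1 + k + 1 - (j + 1) = k + 1 := by omega
  have a3 : j + 1 + k + 1 - (j + 2) = k := by omega
  have b1 : j + 1 + k + 2 - j = k + 3 := by omega
  have b2 : j + 1 + k + 2 - (j + 1) = k + 2 := by omega
  have b3 : j + 1 + k + 2 - (j + 2) = k + 1 := by omega
  unfold auxU
  split_ifs
  · rw [a1, a2, a3]; simp only [auxRs]; ring
  · rw [b1, b2, b3]; simp only [auxRs]; ring

theorem auxU_wronskian {S : Type*} [CommRing S] (x y z : S) (n i m k : ℕ) (h : i + k + m = n) :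
    auxU x y z n 0 i * auxU x y z n 1 (i + m + 1) - auxU x y z n 1 i * auxU x y z n 0 (i + m + 1)
      = z ^ (n + 2) * (x ^ i * z ^ k * auxRs y (x * z) 0 1 (m + 1)) := by
  subst h
  have a1 : i + k + m + 1 - i = k + m + 1 := by omega
  have a2 : i + k + m + 2 - i = k + m + 2 := by omega
  have a3 : i + k + m + 1 - (i + m + 1) = k := by omega
  have a4 : i + k + m + 2 - (i + m + 1) = k + 1 := by omega
  have hw := auxRs_wronskian y (x * z) i (m + 1)
  rw [← add_assoc] at hw
  simp only [auxU, a1, a2, a3, a4, if_true, one_ne_zero, if_false]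
  rw [mul_pow] at hw
  linear_combination (z ^ (k + m + 1) * z ^ (k + 1)) * hw

variable {R : Type*} [CommRing R]

/-- The spanning set of forms of degree `n`. -/
noncomputable def auxSpan (R : Type*) [CommRing R] (n : ℕ) : Submodule R (MvPolynomial (Fin 3) R) :=
  Submodule.span R {g | ∃ i k m : ℕ, i + k + m = n ∧
    g = X 0 ^ i * X 2 ^ k * auxRs (X 1) (X 0 * X 2) 0 1 (m + 1)}

theorem auxSpan_mul (n : ℕ) (v : Fin 3) (g : MvPolynomial (Fin 3) R) (hg : g ∈ auxSpan R n) :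
    X v * g ∈ auxSpan R (n + 1) := by
  induction hg using Submodule.span_induction with
  | zero => simp
  | add a b _ _ ha hb => rw [mul_add]; exact add_mem ha hb
  | smul c a _ ha => rw [mul_smul_comm]; exact Submodule.smul_mem _ _ ha
  | mem g hg =>
    obtain ⟨i, k, m, h, rfl⟩ := hg
    fin_cases v
    · exact Submodule.subset_span ⟨i + 1, k, m, by omega, by simp; ring⟩
    · have h1 : X 0 ^ i * X 2 ^ k * auxRs (X 1) (X 0 * X 2) 0 1 (m + 2) ∈ auxSpan R (n + 1) :=
        Submodule.subset_span ⟨i, k, m + 1, by omega, rfl⟩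
      cases m with
      | zero =>
        have e : (X 1 : MvPolynomial (Fin 3) R) *
            (X 0 ^ i * X 2 ^ k * auxRs (X 1) (X 0 * X 2) 0 1 (0 + 1)) =
            -(X 0 ^ i * X 2 ^ k * auxRs (X 1) (X 0 * X 2) 0 1 (0 + 2)) := by
          simp only [auxRs, zero_add]; ring
        change X 1 * _ ∈ _
        rw [e]; exact neg_mem h1
      | succ m =>
        have h2 : X 0 ^ (i + 1) * X 2 ^ (k + 1) * auxRs (X 1) (X 0 * X 2) 0 1 (m + 1)
            ∈ auxSpan R (n + 1) :=
          Submodule.subset_span ⟨i + 1, k + 1, m, by omega, rfl⟩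
        have e : (X 1 : MvPolynomial (Fin 3) R) *
            (X 0 ^ i * X 2 ^ k * auxRs (X 1) (X 0 * X 2) 0 1 (m + 1 + 1)) =
            -(X 0 ^ i * X 2 ^ k * auxRs (X 1) (X 0 * X 2) 0 1 (m + 1 + 2)) -
            X 0 ^ (i + 1) * X 2 ^ (k + 1) * auxRs (X 1) (X 0 * X 2) 0 1 (m + 1) := by
          rw [show m + 1 + 2 = (m + 1) + 2 from rfl, auxRs.eq_3 _ _ _ _ (m + 1)]; ring
        change X 1 * _ ∈ _
        rw [e]; exact sub_mem (neg_mem h1) h2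
    · exact Submodule.subset_span ⟨i, k + 1, m, by omega, by simp; ring⟩

theorem auxMonomial_succ (n : ℕ) (s : Fin 3 →₀ ℕ) (hs : s.degree = n + 1) :
    ∃ (v : Fin 3) (s' : Fin 3 →₀ ℕ), s'.degree = n ∧
      (monomial s 1 : MvPolynomial (Fin 3) R) = X v * monomial s' 1 := by
  have hne : s ≠ 0 := by rintro rfl; simp at hs
  obtain ⟨v, hv⟩ := Finsupp.ne_iff.mp hne
  have hle : Finsupp.single v 1 ≤ s := by
    rw [Finsupp.single_le_iff]; exact Nat.one_le_iff_ne_zero.mpr hv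
  have e : Finsupp.single v 1 + (s - Finsupp.single v 1) = s := add_tsub_cancel_of_le hle
  refine ⟨v, s - Finsupp.single v 1, ?_, ?_⟩
  · have := congrArg Finsupp.degree e
    rw [map_add, Finsupp.degree_single, hs] at this
    omega
  · rw [X, monomial_mul, e, one_mul]

theorem auxSpan_monomial (n : ℕ) (s : Fin 3 →₀ ℕ) (hs : s.degree = n) :
    (monomial s 1 : MvPolynomial (Fin 3) R) ∈ auxSpan R n := by
  induction n generalizing s with
  | zero =>
    rw [Finsupp.degree_eq_zero_iff] at hs
    subst hs
    exact Submodule.subset_span ⟨0, 0, 0, rfl, by simp [auxRs]⟩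
  | succ n ih =>
    obtain ⟨v, s', h1, h2⟩ := auxMonomial_succ (R := R) n s hs
    rw [h2]
    exact auxSpan_mul n v _ (ih s' h1)

/-- The Pfaffian of the construction, as a linear map in the free entries. -/
noncomputable def auxPhi {R ι : Type*} [CommRing R] [Fintype ι]
    (w : ι → ι → MvPolynomial (Fin 3) R) :
    (Fin 3 → Matrix ι ι R) →ₗ[R] MvPolynomial (Fin 3) R where
  toFun Y := ∑ v, ∑ i, ∑ j, (Y v i j) • (X v * w i j)
  map_add' Y Y' := by simp [add_smul, Finset.sum_add_distrib]
  map_smul' c Y := by simp [mul_smul, Finset.smul_sum]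

theorem auxPhi_single {R ι : Type*} [CommRing R] [Fintype ι] [DecidableEq ι]
    (w : ι → ι → MvPolynomial (Fin 3) R) (v : Fin 3) (i j : ι) :
    auxPhi w (Pi.single v (Matrix.single i j 1)) = X v * w i j := by
  simp only [auxPhi, LinearMap.coe_mk, AddHom.coe_mk]
  rw [Finset.sum_eq_single v, Finset.sum_eq_single i, Finset.sum_eq_single j]
  · simp
  · intro b _ hb; simp [Matrix.single, hb.symm]
  · simp
  · intro b _ hb; simp [Matrix.single, hb.symm]
  · simp
  · intro b _ hb; simp [hb]
  · simp

/-- Surjectivity of the linear map onto forms of degree `n + 1`. -/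
theorem auxPhi_surj (n : ℕ) (f : MvPolynomial (Fin 3) R) (hf : f.IsHomogeneous (n + 1)) :
    ∃ Y : Fin 3 → Matrix (Fin 2 ⊕ Fin n) (Fin 2 ⊕ Fin n) R,
      auxPhi (fun i j => auxU (X 0) (X 1) (X 2) n 0 (auxIdx i) * auxU (X 0) (X 1) (X 2) n 1 (auxIdx j)
        - auxU (X 0) (X 1) (X 2) n 1 (auxIdx i) * auxU (X 0) (X 1) (X 2) n 0 (auxIdx j)) Y
        = X 2 ^ (n + 2) * f := by
  set w : (Fin 2 ⊕ Fin n) → (Fin 2 ⊕ Fin n) → MvPolynomial (Fin 3) R := fun i j =>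
    auxU (X 0) (X 1) (X 2) n 0 (auxIdx i) * auxU (X 0) (X 1) (X 2) n 1 (auxIdx j)
        - auxU (X 0) (X 1) (X 2) n 1 (auxIdx i) * auxU (X 0) (X 1) (X 2) n 0 (auxIdx j) with hw
  change X 2 ^ (n + 2) * f ∈ LinearMap.range (auxPhi w)
  have step : ∀ v : Fin 3, ∀ g ∈ auxSpan R n,
      X 2 ^ (n + 2) * (X v * g) ∈ LinearMap.range (auxPhi w) := by
    intro v g hg
    induction hg using Submodule.span_induction with
    | zero => simp
    | add a b _ _ ha hb => rw [mul_add, mul_add]; exact add_mem ha hb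
    | smul c a _ ha =>
      rw [mul_smul_comm, mul_smul_comm]; exact Submodule.smul_mem _ _ ha
    | mem g hg =>
      obtain ⟨i, k, m, h, rfl⟩ := hg
      obtain ⟨a, ha⟩ := auxIdx_surj (n := n) (i := i) (by omega)
      obtain ⟨b, hb⟩ := auxIdx_surj (n := n) (i := i + m + 1) (by omega)
      refine ⟨Pi.single v (Matrix.single a b 1), ?_⟩
      rw [auxPhi_single]
      simp only [hw, ha, hb]
      rw [auxU_wronskian _ _ _ n i m k h]
      ring
  rw [f.as_sum, Finset.mul_sum]
  refine Submodule.sum_mem _ fun s hs => ?_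
  have hdeg : s.degree = n + 1 := by
    have := hf (mem_support_iff.mp hs)
    rw [Finsupp.degree_eq_weight_one]; exact this
  obtain ⟨v, s', h1, h2⟩ := auxMonomial_succ (R := R) n s hdeg
  have e : monomial s (coeff s f) = coeff s f • (monomial s 1 : MvPolynomial (Fin 3) R) := by
    simp [smul_monomial]
  rw [e, mul_smul_comm, h2]
  exact Submodule.smul_mem _ _ (step v _ (auxSpan_monomial n s' h1))

theorem auxMain (n : ℕ) (f : MvPolynomial (Fin 3) R) (hf : f.IsHomogeneous (n + 1)) :
    ∃ A : Fin 3 → Matrix ((Fin 2 ⊕ Fin n) ⊕ Fin n) ((Fin 2 ⊕ Fin n) ⊕ Fin n) R,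
      (∀ v, (A v)ᵀ = - A v) ∧
      (∑ v, (X v : MvPolynomial (Fin 3) R) • (A v).map C).det = f ^ 2 := by
  obtain ⟨Y, hY⟩ := auxPhi_surj n f hf
  refine ⟨fun v => fromBlocks (Y v - (Y v)ᵀ) (auxB R n v) (-(auxB R n v)ᵀ) 0, ?_, ?_⟩
  · intro v
    simp [fromBlocks_transpose, fromBlocks_neg]
  set Z : Matrix (Fin 2 ⊕ Fin n) (Fin 2 ⊕ Fin n) (MvPolynomial (Fin 3) R) :=
    ∑ v, (X v : MvPolynomial (Fin 3) R) • (Y v).map C with hZ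
  set B : Matrix (Fin 2 ⊕ Fin n) (Fin n) (MvPolynomial (Fin 3) R) :=
    ∑ v : Fin 3, (X v : MvPolynomial (Fin 3) R) • (auxB R n v).map C with hB
  have hM : (∑ v : Fin 3, (X v : MvPolynomial (Fin 3) R) •
      (fromBlocks (Y v - (Y v)ᵀ) (auxB R n v) (-(auxB R n v)ᵀ) 0).map C)
      = fromBlocks (Z - Zᵀ) B (-Bᵀ) 0 := by
    ext1 i j
    rcases i with i | i <;> rcases j with j | j <;>
      simp [hZ, hB, Matrix.sum_apply, Fin.sum_univ_three] <;> ring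
  rw [hM]
  let N : Matrix (Fin 2) (Fin 2 ⊕ Fin n) (MvPolynomial (Fin 3) R) :=
    Matrix.of fun r k => auxU (X 0) (X 1) (X 2) n r (auxIdx k)
  have hBk : ∀ k j, B k j = (if auxIdx k = (j : ℕ) then X 0 else 0)
      + (if auxIdx k = (j : ℕ) + 1 then X 1 else 0)
      + (if auxIdx k = (j : ℕ) + 2 then X 2 else 0) := by
    intro k j
    simp only [hB, Fin.sum_univ_three, auxB, Matrix.add_apply, Matrix.smul_apply,
      Matrix.map_apply, Matrix.of_apply, smul_eq_mul]
    congr 1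
    · congr 1
      · split_ifs <;> simp_all
      · split_ifs <;> simp_all
    · split_ifs <;> simp_all
  have hNB : N * B = 0 := by
    ext1 r j
    rw [Matrix.mul_apply]
    simp only [hBk, N, Matrix.of_apply]
    rw [auxIdx_sum (n := n) (fun k => auxU (X 0) (X 1) (X 2) n r k *
      ((if k = (j : ℕ) then X 0 else 0) + (if k = (j : ℕ) + 1 then X 1 else 0)
      + (if k = (j : ℕ) + 2 then X 2 else 0)))]
    simp only [mul_add, mul_ite, mul_zero, Finset.sum_add_distrib, Finset.sum_ite_eq',
      Finset.mem_range]
    have hj := j.isLt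
    rw [if_pos (by omega), if_pos (by omega), if_pos (by omega)]
    exact auxU_rec _ _ _ n r j hj
  have hNc : N = fromCols ((X 2 ^ (n + 1) : MvPolynomial (Fin 3) R) • 1) N.toCols₂ := by
    ext1 r k
    rcases k with k | k
    · fin_cases r <;> fin_cases k <;> simp [N, auxU, auxIdx, auxRs]
    · rfl
  have hBr : B = fromRows B.toRows₁ B.toRows₂ := (fromRows_toRows B).symm
  have hB2 : B.toRows₂.det = X 2 ^ n := by
    have ht : B.toRows₂.BlockTriangular id := by
      intro i j hij
      have hij' : (j : ℕ) < i := hij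
      change B (Sum.inr i) j = 0
      rw [hBk]
      have e : auxIdx (Sum.inr i : Fin 2 ⊕ Fin n) = (i : ℕ) + 2 := rfl
      rw [e, if_neg (by omega), if_neg (by omega), if_neg (by omega)]
      simp
    rw [det_of_isUpperTriangular ht]
    have : ∀ i, B.toRows₂ i i = X 2 := by
      intro i
      change B (Sum.inr i) i = _
      rw [hBk]
      have e : auxIdx (Sum.inr i : Fin 2 ⊕ Fin n) = (i : ℕ) + 2 := rfl
      rw [e, if_neg (by omega), if_neg (by omega), if_pos rfl]
      simp
    rw [Finset.prod_congr rfl fun i _ => this i]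
    simp
  have hred := aux_det_reduce (Z - Zᵀ) B.toRows₁ B.toRows₂ (X 2 ^ (n + 1)) N.toCols₂
    (by rw [← hNc, ← hBr]; exact hNB)
  rw [← hNc, ← hBr, hB2] at hred
  have hE : (N * (Z - Zᵀ) * Nᵀ).det = (X 2 ^ (n + 2) * f) ^ 2 := by
    have e1 : N * (Z - Zᵀ) * Nᵀ = N * Z * Nᵀ - (N * Z * Nᵀ)ᵀ := by
      simp [Matrix.mul_sub, Matrix.sub_mul, transpose_mul, Matrix.mul_assoc]
    have e2 : (N * Z * Nᵀ) 0 1 - (N * Z * Nᵀ) 1 0 = X 2 ^ (n + 2) * f := by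
      rw [← hY]
      have e3 : ∀ r s, (N * Z * Nᵀ) r s = ∑ v, ∑ i, ∑ j, (Y v i j) •
          (X v * (N r i * N s j)) := by
        intro r s
        simp only [Matrix.mul_apply, hZ, Matrix.sum_apply, Matrix.smul_apply, Matrix.map_apply,
          Matrix.transpose_apply, Finset.sum_mul, Finset.mul_sum, smul_eq_mul]
        rw [Finset.sum_comm]
        simp only [Finset.sum_comm (s := (Finset.univ : Finset (Fin 2 ⊕ Fin n)))
          (t := (Finset.univ : Finset (Fin 3)))]
        refine Finset.sum_congr rfl fun v _ => Finset.sum_congr rfl fun i _ =>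
          Finset.sum_congr rfl fun j _ => ?_
        rw [smul_eq_C_mul]
        ring
      rw [e3, e3]
      simp only [auxPhi, LinearMap.coe_mk, AddHom.coe_mk, ← Finset.sum_sub_distrib, ← smul_sub,
        ← mul_sub]
      rfl
    rw [e1, det_fin_two, ← e2]
    simp only [Matrix.sub_apply, Matrix.transpose_apply]
    ring
  rw [hE, Fintype.card_fin] at hred
  have hreg : IsLeftRegular ((X 2 : MvPolynomial (Fin 3) R) ^ (4 * (n + 1))) :=
    (isRegular_X_pow _).left
  apply hreg
  linear_combination hred

end Aux

/-- For every homogeneous `f ∈ R[X₀,X₁,X₂]` of degree `d`, `2 ≤ d ≤ 25`, there are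
`2d × 2d` skew-symmetric matrices `A₀, A₁, A₂` over `R` with
`det(X₀·A₀ + X₁·A₁ + X₂·A₂) = f²`. -/
theorem every_ternary_form_of_degree_le_25_admits_linear_determinantal_pfaffian_representation
    {R : Type*} [CommRing R] (d : ℕ) (hd2 : 2 ≤ d) (hd25 : d ≤ 25)
    (f : MvPolynomial (Fin 3) R) (hf : f.IsHomogeneous d) :
    ∃ A₀ A₁ A₂ : Matrix (Fin (2 * d)) (Fin (2 * d)) R,
      A₀ᵀ = -A₀ ∧ A₁ᵀ = -A₁ ∧ A₂ᵀ = -A₂ ∧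
      ((X 0 : MvPolynomial (Fin 3) R) • A₀.map C + (X 1 : MvPolynomial (Fin 3) R) • A₁.map C +
          (X 2 : MvPolynomial (Fin 3) R) • A₂.map C : Matrix (Fin (2 * d)) (Fin (2 * d)) (MvPolynomial (Fin 3) R)).det = f ^ 2 := by
  obtain ⟨n, rfl⟩ : ∃ n, d = n + 1 := ⟨d - 1, by omega⟩
  obtain ⟨A, hA, hdet⟩ := auxMain n f hf
  have hc : Fintype.card (Fin (2 * (n + 1))) = Fintype.card ((Fin 2 ⊕ Fin n) ⊕ Fin n) := by
    simp; omega
  let e := Fintype.equivOfCardEq hc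
  have hs : ∀ v, ((A v).submatrix e e)ᵀ = -(A v).submatrix e e := by
    intro v
    rw [transpose_submatrix, hA]
    rfl
  refine ⟨(A 0).submatrix e e, (A 1).submatrix e e, (A 2).submatrix e e, hs 0, hs 1, hs 2, ?_⟩
  rw [← hdet, ← det_submatrix_equiv_self e, Fin.sum_univ_three]
  rfl
end

section
/- Let R be a commutative ring with 1 and let d be an integer with 5 ≤ d ≤ 25. Write a homogeneous polynomial f ∈ R[X₀,X₁,X₂] of degree d as f = Σ_{i+j+k=d} Θ_{ijk}·X₀^i X₁^j X₂^k with Θ_{ijk} ∈ R. Then f admits a linear Pfaffian R-representation M = X₀·A₀ + X₁·A₁ + X₂·A₂ (with A₀,A₁,A₂ skew-symmetric 2d×2d matrices over R and Pf(M) = f) which moreover has the following structure: the entry M_{1,2} has X₀-coefficient Θ_{d00}, the entry M_{2,3} has X₁-coefficient Θ_{0d0}, the entry M_{3,4} has X₂-coefficient Θ_{00d}, and M_{i,j} = 0 for all i, j with d+2 ≤ i < j ≤ 2d (i.e. the bottom-right (d−1)×(d−1) block of M is zero). -/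
open MvPolynomial Matrix

namespace PfAux

lemma succAbove_val {n : ℕ} (p : Fin (n + 1)) (i : Fin n) :
    (p.succAbove i).val = if i.val < p.val then i.val else i.val + 1 := by
  unfold Fin.succAbove
  simp only [Fin.lt_def, Fin.val_castSucc]
  split_ifs <;> simp

/-- The recursive expansion of the Pfaffian of `[[B, L], [-Lᵀ, 0]]`, where `L` consists of the
first `k` columns of `W`. -/
def PL {A : Type*} [CommRing A] : (k : ℕ) → Matrix (Fin (k + 2)) (Fin (k + 2)) A →
    Matrix (Fin (k + 2)) (Fin (k + 2)) A → A
  | 0, B, _ => - B 1 0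
  | k + 1, B, W => ∑ j : Fin (k + 3), (-1 : A) ^ (j : ℕ) * W j 0 *
      PL k (B.submatrix j.succAbove j.succAbove) (W.submatrix j.succAbove Fin.succ)

section
variable {A : Type*} [CommRing A]

lemma PL_add (k : ℕ) (B B' W : Matrix (Fin (k + 2)) (Fin (k + 2)) A) :
    PL k (B + B') W = PL k B W + PL k B' W := by
  induction k with
  | zero => simp [PL]; ring
  | succ k ih =>
    simp only [PL, ← Finset.sum_add_distrib]
    refine Finset.sum_congr rfl fun j _ => ?_
    rw [Matrix.submatrix_add, Pi.add_apply, Pi.add_apply, ih]; ring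

lemma PL_smul (k : ℕ) (c : A) (B W : Matrix (Fin (k + 2)) (Fin (k + 2)) A) :
    PL k (c • B) W = c * PL k B W := by
  induction k with
  | zero => simp [PL]
  | succ k ih =>
    simp only [PL, Finset.mul_sum]
    refine Finset.sum_congr rfl fun j _ => ?_
    rw [Matrix.submatrix_smul, Pi.smul_apply, Pi.smul_apply, ih]; ring

lemma PL_congr (k : ℕ) (B W W' : Matrix (Fin (k + 2)) (Fin (k + 2)) A)
    (h : ∀ i j, j.val < k → W i j = W' i j) : PL k B W = PL k B W' := by
  induction k with
  | zero => simp [PL]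
  | succ k ih =>
    simp only [PL]
    refine Finset.sum_congr rfl fun j _ => ?_
    rw [h j 0 (by simp), ih _ _ (W'.submatrix j.succAbove Fin.succ)]
    intro i c hc
    exact h _ _ (by simpa using hc)

lemma PL_det (k : ℕ) (B W : Matrix (Fin (k + 2)) (Fin (k + 2)) A)
    (h : ∀ i j, B i j = W i (Fin.last k).castSucc * W j (Fin.last (k + 1))
      - W j (Fin.last k).castSucc * W i (Fin.last (k + 1))) : PL k B W = W.det := by
  induction k with
  | zero =>
    rw [show W.det = _ from Matrix.det_fin_two W]
    simp only [PL, h]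
    have h0 : (Fin.last 0).castSucc = (0 : Fin 2) := rfl
    have h1 : (Fin.last (0 + 1)) = (1 : Fin 2) := rfl
    rw [h0, h1]; ring
  | succ k ih =>
    simp only [PL, Matrix.det_succ_column_zero W]
    refine Finset.sum_congr rfl fun j _ => ?_
    rw [ih _ (W.submatrix j.succAbove Fin.succ)]
    intro a b
    exact h _ _

lemma pf_eq (k : ℕ) : ∀ (M : Matrix (Fin (2 * (k + 1))) (Fin (2 * (k + 1))) A)
    (B W : Matrix (Fin (k + 2)) (Fin (k + 2)) A)
    (_ : ∀ (i j : Fin (2 * (k + 1))) (hi : i.val < k + 2) (hj : j.val < k + 2),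
      M i j = B ⟨i, hi⟩ ⟨j, hj⟩)
    (_ : ∀ (r j : Fin (2 * (k + 1))) (c : Fin (k + 2)), c.val < k →
      r.val + c.val = 2 * k + 1 → ∀ hj : j.val < k + 2, M r j = - W ⟨j, hj⟩ c)
    (_ : ∀ r j : Fin (2 * (k + 1)), k + 2 ≤ r.val → k + 2 ≤ j.val → M r j = 0),
    matrixPfaffian (k + 1) M = PL k B W := by
  induction k with
  | zero =>
    intro M B W hB _ _
    simp only [matrixPfaffian, PL, Nat.mul_zero, Fin.sum_univ_succ, Fin.sum_univ_zero]
    rw [hB _ _ (by simp) (by simp)]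
    simp
  | succ k ih =>
    intro M B W hB hL h0
    rw [matrixPfaffian, PL]
    have key : ∀ g : ℕ → A, (∀ j, k + 3 ≤ j → g j = 0) →
        ∑ j : Fin (2 * (k + 1) + 1), g j = ∑ j : Fin (k + 3), g j := by
      intro g hg
      rw [Fin.sum_univ_eq_sum_range, Fin.sum_univ_eq_sum_range]
      symm
      apply Finset.sum_subset
      · intro a; simp only [Finset.mem_range]; omega
      · intro a _ ha
        exact hg _ (by simpa using ha)
    let g : ℕ → A := fun j => if h : j < k + 3 then
      (-1 : A) ^ j * W ⟨j, h⟩ 0 *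
      PL k (B.submatrix (Fin.succAbove ⟨j, h⟩) (Fin.succAbove ⟨j, h⟩))
        (W.submatrix (Fin.succAbove ⟨j, h⟩) Fin.succ) else 0
    trans ∑ j : Fin (2 * (k + 1) + 1), g j
    · refine Finset.sum_congr rfl fun j _ => ?_
      by_cases hj : j.val < k + 3
      · simp only [g, hj, dif_pos]
        have e1 := hL (Fin.last (2 * (k + 1) + 1)) j.castSucc 0 (by simp) (by simp)
          (by simpa using hj)
        refine (congrArg₂ (· * ·) (congrArg ((-1 : A) ^ (j.val + 1) * ·) e1) (ih _ (B.submatrix (Fin.succAbove ⟨j, hj⟩) (Fin.succAbove ⟨j, hj⟩))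
          (W.submatrix (Fin.succAbove ⟨j, hj⟩) Fin.succ) ?_ ?_ ?_)).trans ?_
        rotate_right
        · simp only [Fin.val_castSucc]; ring
        · intro a b ha hb
          have h1 : ∀ (a : Fin (2 * (k + 1))) (ha : a.val < k + 2), (j.succAbove a).castSucc.val =
              (Fin.succAbove (⟨j, hj⟩ : Fin (k + 3)) (⟨a, ha⟩ : Fin (k + 2))).val := by
            intro a ha; simp [succAbove_val]
          rw [hB _ _ (by rw [h1 a ha]; exact Fin.isLt _) (by rw [h1 b hb]; exact Fin.isLt _)]
          simp only [Matrix.submatrix_apply]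
          congr 1 <;> ext <;> simp [succAbove_val]
        · intro r b c hc hr hb
          rw [hL _ _ c.succ (by simpa using hc) (by
            rw [Fin.val_castSucc, succAbove_val, Fin.val_succ]; split_ifs <;> omega) (by
            rw [Fin.val_castSucc, succAbove_val]; split_ifs <;> omega)]
          simp only [Matrix.submatrix_apply]
          congr 2; ext; simp [succAbove_val]
        · intro r b hr hb
          apply h0 <;> rw [Fin.val_castSucc, succAbove_val] <;> split_ifs <;> omega
      · simp only [g, hj, dif_neg, not_false_eq_true]
        rw [h0]
        · ring
        · simp; omega
        · simp; omega
    · rw [key g (by intro j hj; simp only [g]; rw [dif_neg (by omega)])]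
      refine Finset.sum_congr rfl fun j _ => ?_
      simp [g]

end
section
variable {A : Type*} [CommRing A]

lemma det_row_single {n : ℕ} (M : Matrix (Fin (n + 1)) (Fin (n + 1)) A) (i j : Fin (n + 1))
    (h : ∀ c, c ≠ j → M i c = 0) :
    M.det = (-1) ^ (i + j : ℕ) * M i j * (M.submatrix i.succAbove j.succAbove).det := by
  rw [Matrix.det_succ_row M i, Finset.sum_eq_single j]
  · intro b _ hb; rw [h b hb]; ring
  · simp

lemma det_col_single {n : ℕ} (M : Matrix (Fin (n + 1)) (Fin (n + 1)) A) (i j : Fin (n + 1))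
    (h : ∀ c, c ≠ i → M c j = 0) :
    M.det = (-1) ^ (i + j : ℕ) * M i j * (M.submatrix i.succAbove j.succAbove).det := by
  rw [Matrix.det_succ_column M j, Finset.sum_eq_single i]
  · intro b _ hb; rw [h b hb]; ring
  · simp

/-- Banded matrix: column `j` has `z`, `y`, `x` in rows `j`, `j+1`, `j+2`. -/
def band (x y z : A) (i j : ℕ) : A :=
  if i = j then z else if i = j + 1 then y else if i = j + 2 then x else 0

/-- The matrix `[L | u | v]`. -/
def aug (k : ℕ) (L : ℕ → ℕ → A) (u v : ℕ → A) : Matrix (Fin (k + 2)) (Fin (k + 2)) A :=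
  Matrix.of fun i j => if j.val < k then L i j else if j.val = k then u i else v i

lemma corner_z (k : ℕ) : ∀ u v : ℕ → A,
    (aug k (band 0 0 1) u v).det = u k * v (k + 1) - u (k + 1) * v k := by
  induction k with
  | zero => intro u v; rw [show (aug 0 (band 0 0 1) u v).det = _ from Matrix.det_fin_two _]
            simp [aug]; ring
  | succ k ih =>
    intro u v
    rw [det_col_single _ 0 0]
    · have := ih (fun i => u (i + 1)) (fun i => v (i + 1))
      rw [show (aug (k + 1) (band (0 : A) 0 1) u v).submatrix (Fin.succAbove 0) (Fin.succAbove 0) =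
        aug k (band 0 0 1) (fun i => u (i + 1)) (fun i => v (i + 1)) from ?_, this]
      · simp [aug, band]
      · ext i j
        simp [aug, band]
    · intro c hc
      have : c.val ≠ 0 := fun h => hc (Fin.ext h)
      simp [aug, band, this]

lemma corner_x (k : ℕ) : ∀ u v : ℕ → A,
    (aug k (band 1 0 0) u v).det = u 0 * v 1 - u 1 * v 0 := by
  induction k with
  | zero => intro u v; rw [show (aug 0 (band 1 0 0) u v).det = _ from Matrix.det_fin_two _]
            simp [aug]; ring
  | succ k ih =>
    intro u v
    rw [det_col_single _ ⟨2, by omega⟩ 0]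
    · have := ih (fun i => u (if i < 2 then i else i + 1)) (fun i => v (if i < 2 then i else i + 1))
      rw [show (aug (k + 1) (band (1 : A) 0 0) u v).submatrix (Fin.succAbove ⟨2, by omega⟩)
          (Fin.succAbove 0) =
        aug k (band 1 0 0) (fun i => u (if i < 2 then i else i + 1))
          (fun i => v (if i < 2 then i else i + 1)) from ?_, this]
      · simp [aug, band]
      · ext i j
        simp only [aug, band, Matrix.submatrix_apply, Matrix.of_apply, succAbove_val]
        grind
    · intro c hc
      have : c.val ≠ 2 := fun h => hc (Fin.ext h)
      simp [aug, band, this]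

lemma corner_y (k : ℕ) : ∀ u v : ℕ → A,
    (aug k (band 0 1 0) u v).det = (-1) ^ k * (u 0 * v (k + 1) - u (k + 1) * v 0) := by
  induction k with
  | zero => intro u v; rw [show (aug 0 (band 0 1 0) u v).det = _ from Matrix.det_fin_two _]
            simp [aug]; ring
  | succ k ih =>
    intro u v
    rw [det_col_single _ ⟨1, by omega⟩ 0]
    · have := ih (fun i => u (if i < 1 then i else i + 1)) (fun i => v (if i < 1 then i else i + 1))
      rw [show (aug (k + 1) (band (0 : A) 1 0) u v).submatrix (Fin.succAbove ⟨1, by omega⟩)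
          (Fin.succAbove 0) =
        aug k (band 0 1 0) (fun i => u (if i < 1 then i else i + 1))
          (fun i => v (if i < 1 then i else i + 1)) from ?_, this]
      · simp [aug, band]; ring
      · ext i j
        simp only [aug, band, Matrix.submatrix_apply, Matrix.of_apply, succAbove_val]
        grind
    · intro c hc
      have : c.val ≠ 1 := fun h => hc (Fin.ext h)
      simp [aug, band, this]

lemma row_zero (k : ℕ) (x y z : A) (u v : ℕ → A) (hu : u 0 = 0) (hv : v 0 = 0) :
    (aug (k + 1) (band x y z) u v).det =
      z * (aug k (band x y z) (fun i => u (i + 1)) (fun i => v (i + 1))).det := by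
  rw [det_row_single _ 0 0]
  · rw [show (aug (k + 1) (band x y z) u v).submatrix (Fin.succAbove 0) (Fin.succAbove 0) =
        aug k (band x y z) (fun i => u (i + 1)) (fun i => v (i + 1)) from ?_]
    · simp [aug, band]
    · ext i j
      simp [aug, band]
  · intro c hc
    have : c.val ≠ 0 := fun h => hc (Fin.ext h)
    simp [aug, band, hu, hv, this.symm]

lemma row_one (k : ℕ) (x y : A) (u v : ℕ → A) (hu : u 1 = 0) (hv : v 1 = 0) :
    (aug (k + 1) (band x y 0) u v).det =
      - y * (aug k (band x y 0) (fun i => u (if i < 1 then i else i + 1))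
        (fun i => v (if i < 1 then i else i + 1))).det := by
  rw [det_row_single _ ⟨1, by omega⟩ 0]
  · rw [show (aug (k + 1) (band x y 0) u v).submatrix (Fin.succAbove ⟨1, by omega⟩)
          (Fin.succAbove 0) =
        aug k (band x y 0) (fun i => u (if i < 1 then i else i + 1))
          (fun i => v (if i < 1 then i else i + 1)) from ?_]
    · simp [aug, band]
    · ext i j
      simp only [aug, band, Matrix.submatrix_apply, Matrix.of_apply, succAbove_val]
      grind
  · intro c hc
    have : c.val ≠ 0 := fun h => hc (Fin.ext h)
    simp [aug, band, hu, hv]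
    grind

lemma row_last (k : ℕ) (x y z : A) (u v : ℕ → A) (hu : u (k + 2) = 0) (hv : v (k + 2) = 0) :
    (aug (k + 1) (band x y z) u v).det = x * (aug k (band x y z) u v).det := by
  rw [det_row_single _ ⟨k + 2, by omega⟩ ⟨k, by omega⟩]
  · rw [show (aug (k + 1) (band x y z) u v).submatrix (Fin.succAbove ⟨k + 2, by omega⟩)
          (Fin.succAbove ⟨k, by omega⟩) = aug k (band x y z) u v from ?_]
    · have : (-1 : A) ^ (k + 2 + k) = 1 := Even.neg_one_pow ⟨k + 1, by ring⟩
      simp [aug, band, this]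
    · ext i j
      simp only [aug, band, Matrix.submatrix_apply, Matrix.of_apply, succAbove_val]
      grind
  · intro c hc
    have : c.val ≠ k := fun h => hc (Fin.ext h)
    simp [aug, band, hu, hv]
    grind

/-- Unit vectors. -/
def e (a : ℕ) (i : ℕ) : A := if i = a then 1 else 0

lemma edge (x y : A) (k : ℕ) : ∀ b ≤ k,
    (aug k (band x y 0) (e 0) (e (b + 1))).det = (-y) ^ b * x ^ (k - b) := by
  induction k with
  | zero =>
    intro b hb
    obtain rfl : b = 0 := by omega
    rw [show (aug 0 (band x y 0) (e 0) (e (0 + 1))).det = _ from Matrix.det_fin_two _]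
    simp [aug, e]
  | succ k ih =>
    intro b hb
    rcases b with _ | b
    · rw [row_last _ _ _ _ _ _ (by simp [e]) (by simp [e]), ih 0 (by omega)]
      simp; ring
    · rw [row_one _ _ _ _ _ (by simp [e]) (by simp [e])]
      have h1 : (fun i => (e 0 (if i < 1 then i else i + 1) : A)) = e 0 := by
        ext i; simp only [e]; grind
      have h2 : (fun i => (e (b + 1 + 1) (if i < 1 then i else i + 1) : A)) = e (b + 1) := by
        ext i; simp only [e]; grind
      rw [h1, h2, ih b (by omega)]
      rw [show k + 1 - (b + 1) = k - b by omega]; ring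

lemma aug_shift (k : ℕ) (x y z : A) (a b : ℕ) :
    (aug (k + 1) (band x y z) (e (a + 1)) (e (b + 1))).det =
      z * (aug k (band x y z) (e a) (e b)).det := by
  rw [row_zero _ _ _ _ _ _ (by simp [e]) (by simp [e])]
  simp [e]; rfl

lemma aug_map {A' : Type*} [CommRing A'] (φ : A →+* A') (k : ℕ) (x y z : A) (u v : ℕ → A) :
    φ (aug k (band x y z) u v).det =
      (aug k (band (φ x) (φ y) (φ z)) (fun i => φ (u i)) (fun i => φ (v i))).det := by
  rw [RingHom.map_det]
  congr 1
  ext i j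
  simp only [aug, band, RingHom.mapMatrix_apply, Matrix.map_apply, Matrix.of_apply]
  split_ifs <;> simp

lemma map_e {A' : Type*} [CommRing A'] (φ : A →+* A') (a : ℕ) :
    (fun i => φ (e a i)) = e a := by
  ext i; simp only [e]; split_ifs <;> simp

end
section
variable {R : Type*} [CommRing R]

lemma aug_homog (k : ℕ) (u v : ℕ → R) :
    (aug k (band (X 0 : MvPolynomial (Fin 3) R) (X 1) (X 2)) (fun i => C (u i))
      (fun i => C (v i))).det.IsHomogeneous k := by
  rw [Matrix.det_apply]
  apply IsHomogeneous.sum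
  intro σ _
  have h : (∏ i, aug k (band (X 0 : MvPolynomial (Fin 3) R) (X 1) (X 2)) (fun i => C (u i))
      (fun i => C (v i)) (σ i) i).IsHomogeneous (∑ i : Fin (k + 2), if i.val < k then 1 else 0) := by
    apply IsHomogeneous.prod
    intro i _
    simp only [aug, band, Matrix.of_apply]
    split_ifs
    · exact isHomogeneous_X _ _
    · exact isHomogeneous_X _ _
    · exact isHomogeneous_X _ _
    · exact isHomogeneous_zero _ _ _
    · exact isHomogeneous_C _ _
    · exact isHomogeneous_C _ _
  have h2 : (∑ i : Fin (k + 2), if i.val < k then 1 else 0) = k := by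
    rw [Fin.sum_univ_castSucc, Fin.sum_univ_castSucc]; simp
  rw [h2] at h
  rcases Int.units_eq_one_or (Equiv.Perm.sign σ) with h' | h' <;> rw [h']
  · simpa using h
  · simpa using h.neg

lemma C_e (a : ℕ) : (fun i => (C (e a i : R) : MvPolynomial (Fin 3) R)) = e a :=
  map_e C a

/-- The maximal minors of the band matrix. -/
noncomputable def T (R : Type*) [CommRing R] (k a b : ℕ) : MvPolynomial (Fin 3) R :=
  (aug k (band (X 0) (X 1) (X 2)) (e a) (e b)).det

lemma T_homog (k a b : ℕ) : (T R k a b).IsHomogeneous k := by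
  have := aug_homog k (e a) (e b : ℕ → R)
  rwa [C_e, C_e] at this

lemma T_dvd (k b : ℕ) (hb : b ≤ k) :
    (X 2 : MvPolynomial (Fin 3) R) ∣ T R k 0 (b + 1) - (-X 1) ^ b * X 0 ^ (k - b) := by
  rw [← edge _ _ k b hb, ← Ideal.mem_span_singleton, ← Ideal.Quotient.mk_eq_mk_iff_sub_mem, T,
    aug_map, aug_map, map_e, map_e, map_zero]
  congr 3
  exact Ideal.Quotient.eq_zero_iff_mem.2 (Ideal.mem_span_singleton_self _)

lemma mem_of_monomials (S : Submodule R (MvPolynomial (Fin 3) R)) (p : MvPolynomial (Fin 3) R)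
    (h : ∀ m, coeff m p ≠ 0 → monomial m (1 : R) ∈ S) : p ∈ S := by
  rw [p.as_sum]
  refine Submodule.sum_mem _ fun m hm => ?_
  have := S.smul_mem (coeff m p) (h m (by simpa using hm))
  simpa [smul_monomial] using this

lemma monomial_mem_span (k : ℕ) : ∀ m : Fin 3 →₀ ℕ, m.degree = k →
    monomial m (1 : R) ∈ Submodule.span R {p | ∃ a b, a < k + 2 ∧ b < k + 2 ∧ p = T R k a b} := by
  induction k with
  | zero =>
    intro m hm
    have hm : m = 0 := (Finsupp.degree_eq_zero_iff m).1 hm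
    subst hm
    apply Submodule.subset_span
    refine ⟨0, 1, by omega, by omega, ?_⟩
    have := edge (X 0 : MvPolynomial (Fin 3) R) (X 1) 0 0 le_rfl
    rw [T, show (aug 0 (band (X 0 : MvPolynomial (Fin 3) R) (X 1) (X 2)) (e 0) (e 1)).det = _ from
      Matrix.det_fin_two _]
    simp [aug, e]
  | succ k ih =>
    set S := Submodule.span R {p | ∃ a b, a < k + 1 + 2 ∧ b < k + 1 + 2 ∧ p = T R (k + 1) a b}
      with hS
    -- multiples of the last variable
    have h1 : ∀ p ∈ Submodule.span R {p | ∃ a b, a < k + 2 ∧ b < k + 2 ∧ p = T R k a b},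
        X 2 * p ∈ S := by
      intro p hp
      induction hp using Submodule.span_induction with
      | mem p hp =>
        obtain ⟨a, b, ha, hb, rfl⟩ := hp
        apply Submodule.subset_span
        exact ⟨a + 1, b + 1, by omega, by omega, (aug_shift k _ _ _ a b).symm⟩
      | zero => simp
      | add p q _ _ hp hq => rw [mul_add]; exact S.add_mem hp hq
      | smul c p _ hp => rw [mul_smul_comm]; exact S.smul_mem c hp
    have h2 : ∀ m : Fin 3 →₀ ℕ, m.degree = k + 1 → m 2 ≠ 0 → monomial m (1 : R) ∈ S := by
      intro m hm h0
      have hle : Finsupp.single 2 1 ≤ m := by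
        rw [Finsupp.single_le_iff]; omega
      obtain ⟨m', rfl⟩ := exists_add_of_le hle
      have hd : m'.degree = k := by
        rw [map_add, Finsupp.degree_single] at hm; omega
      have := h1 _ (ih m' hd)
      rwa [X, monomial_mul, one_mul] at this
    intro m hm
    by_cases h0 : m 2 = 0
    · have hsum : m 0 + m 1 = k + 1 := by
        rw [Finsupp.degree_eq_sum, Fin.sum_univ_three, h0] at hm; omega
      have hmon : monomial m (1 : R) = X 1 ^ m 1 * X 0 ^ m 0 := by
        rw [monomial_eq, Finsupp.prod_fintype _ _ (by simp), Fin.prod_univ_three, h0]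
        simp; ring
      obtain ⟨g, hg⟩ := T_dvd (R := R) (k + 1) (m 1) (by omega)
      have hT : T R (k + 1) 0 (m 1 + 1) ∈ S :=
        Submodule.subset_span ⟨0, m 1 + 1, by omega, by omega, rfl⟩
      rw [show k + 1 - m 1 = m 0 by omega] at hg
      have hq : ((-X 1 : MvPolynomial (Fin 3) R) ^ m 1 * X 0 ^ m 0).IsHomogeneous (k + 1) := by
        have := ((isHomogeneous_X R (1 : Fin 3)).neg.pow (m 1)).mul
          ((isHomogeneous_X R (0 : Fin 3)).pow (m 0))
        rwa [show 1 * m 1 + 1 * m 0 = k + 1 by omega] at this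
      have hdiff := (T_homog (R := R) (k + 1) 0 (m 1 + 1)).sub hq
      have hmem : T R (k + 1) 0 (m 1 + 1) - (-X 1) ^ m 1 * X 0 ^ m 0 ∈ S := by
        apply mem_of_monomials
        intro m' hm'
        refine h2 m' ?_ ?_
        · by_contra hne
          exact hm' (hdiff.coeff_eq_zero hne)
        · intro h
          apply hm'
          rw [hg, coeff_X_mul', if_neg (by simpa using h)]
      have h3 := S.sub_mem hT hmem
      rw [sub_sub_cancel, neg_pow, mul_assoc, ← hmon] at h3
      have h4 := S.smul_mem ((-1 : R) ^ m 1) h3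
      have h5 : (-1 : R) ^ m 1 • ((-1 : MvPolynomial (Fin 3) R) ^ m 1 * monomial m (1 : R)) =
          monomial m (1 : R) := by
        rw [smul_eq_C_mul, C_pow, C_neg, C_1, ← mul_assoc, ← mul_pow]; simp
      rwa [h5] at h4
    · exact h2 m hm h0

lemma coeff_eq_eval (k : ℕ) (p : MvPolynomial (Fin 3) R) (hp : p.IsHomogeneous k) (s : Fin 3) :
    coeff (Finsupp.single s k) p = eval (Pi.single s 1) p := by
  rw [eval_eq', Finset.sum_eq_single (Finsupp.single s k)]
  · rw [Finset.prod_eq_single s]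
    · simp
    · intro b _ hb; simp [hb.symm]
    · simp
  · intro m hm hne
    have hd : m.degree = k := by
      by_contra h
      exact (mem_support_iff.1 hm) (hp.coeff_eq_zero h)
    have : ∃ i, i ≠ s ∧ m i ≠ 0 := by
      by_contra! h
      apply hne
      have hms : m = Finsupp.single s (m s) := by
        ext i
        by_cases hi : i = s
        · subst hi; simp
        · rw [h i hi]; simp [Ne.symm hi]
      rw [hms, Finsupp.degree_single] at hd
      rw [hms, hd]
    obtain ⟨i, hi, hmi⟩ := this
    rw [Finset.prod_eq_zero (Finset.mem_univ i), mul_zero]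
    simp [hi, hmi]
  · intro h
    rw [notMem_support_iff.1 h, zero_mul]

end
section
variable {A : Type*} [CommRing A]

/-- Row signs. -/
def rowSign (k i : ℕ) : ℤˣ :=
  if i = 0 then -1 else if i = 2 then (-1) ^ k else if i = 3 then -(-1) ^ k else 1

/-- Row permutation. -/
def rowPerm (k : ℕ) (hk : 4 ≤ k) : Equiv.Perm (Fin (k + 2)) :=
  Equiv.swap ⟨0, by omega⟩ ⟨1, by omega⟩ * Equiv.swap ⟨2, by omega⟩ ⟨k + 1, by omega⟩ *
    Equiv.swap ⟨3, by omega⟩ ⟨k, by omega⟩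

/-- Global sign. -/
def globSign (k : ℕ) (hk : 4 ≤ k) : ℤˣ :=
  (∏ i : Fin (k + 2), rowSign k i) * Equiv.Perm.sign (rowPerm k hk)

/-- The signed row-permuted band matrix. -/
def Lp (k : ℕ) (hk : 4 ≤ k) (x y z : A) (i : Fin (k + 2)) (c : ℕ) : A :=
  (if c = 0 then ((globSign k hk : ℤ) : A) else 1) *
    (((rowSign k i : ℤ) : A) * band x y z (rowPerm k hk i) c)

/-- The matrix `[Lp | u | v]`. -/
def Wp (k : ℕ) (hk : 4 ≤ k) (x y z : A) (u v : Fin (k + 2) → A) :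
    Matrix (Fin (k + 2)) (Fin (k + 2)) A :=
  Matrix.of fun i j => if j.val < k then Lp k hk x y z i j else if j.val = k then u i else v i

/-- Transport of vectors. -/
def tw (k : ℕ) (hk : 4 ≤ k) (w : ℕ → A) (i : Fin (k + 2)) : A :=
  ((rowSign k i : ℤ) : A) * w (rowPerm k hk i)

lemma det_Wp (k : ℕ) (hk : 4 ≤ k) (x y z : A) (w w' : ℕ → A) :
    (Wp k hk x y z (tw k hk w) (tw k hk w')).det = (aug k (band x y z) w w').det := by
  have h : Wp k hk x y z (tw k hk w) (tw k hk w') =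
      Matrix.of fun i j => (if j = 0 then ((globSign k hk : ℤ) : A) else 1) *
        (Matrix.of fun i j => ((rowSign k i.val : ℤ) : A) *
          ((aug k (band x y z) w w').submatrix (rowPerm k hk) id) i j) i j := by
    ext i j
    have hj0 : j = 0 ↔ j.val = 0 := by rw [Fin.ext_iff]; rfl
    simp only [Wp, Lp, tw, aug, Matrix.of_apply, Matrix.submatrix_apply, id, hj0]
    split_ifs <;> first | omega | ring
  have hcol := Matrix.det_mul_column (fun i : Fin (k + 2) => ((rowSign k i.val : ℤ) : A))
    ((aug k (band x y z) w w').submatrix (rowPerm k hk) id)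
  rw [h, Matrix.det_mul_row]
  refine (congrArg (_ * ·) hcol).trans ?_
  rw [Matrix.det_permute, Finset.prod_ite_eq']
  simp only [Finset.mem_univ, if_true]
  have h2 : ((globSign k hk : ℤ) : A) * ((∏ i : Fin (k + 2), ((rowSign k i : ℤ) : A)) *
      ((Equiv.Perm.sign (rowPerm k hk) : ℤ) : A)) = 1 := by
    have : globSign k hk * ((∏ i : Fin (k + 2), rowSign k i) * Equiv.Perm.sign (rowPerm k hk)) = 1 :=
      Int.units_mul_self _
    have h3 := congrArg (fun u : ℤˣ => ((u : ℤ) : A)) this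
    simpa [Units.coe_prod] using h3
  linear_combination (aug k (band x y z) w w').det * h2

lemma rowPerm_vals (k : ℕ) (hk : 4 ≤ k) :
    (rowPerm k hk ⟨0, by omega⟩).val = 1 ∧ (rowPerm k hk ⟨1, by omega⟩).val = 0 ∧
    (rowPerm k hk ⟨2, by omega⟩).val = k + 1 ∧ (rowPerm k hk ⟨3, by omega⟩).val = k := by
  refine ⟨?_, ?_, ?_, ?_⟩ <;>
  · simp only [rowPerm, Equiv.Perm.mul_apply, Equiv.swap_apply_def, Fin.mk.injEq]
    grind

lemma corner (k : ℕ) (hk : 4 ≤ k) (w w' : ℕ → A) (s : Fin 3) :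
    (aug k (band ((Pi.single s 1 : Fin 3 → A) 0) ((Pi.single s 1 : Fin 3 → A) 1) ((Pi.single s 1 : Fin 3 → A) 2)) w w').det =
    tw k hk w ⟨s, by omega⟩ * tw k hk w' ⟨s + 1, by omega⟩ -
    tw k hk w ⟨s + 1, by omega⟩ * tw k hk w' ⟨s, by omega⟩ := by
  obtain ⟨h0, h1, h2, h3⟩ := rowPerm_vals k hk
  have h0' : (rowPerm k hk 0).val = 1 := h0
  have h1' : (rowPerm k hk 1).val = 0 := by simpa using h1
  fin_cases s
  · have := corner_x k w w'
    simp [tw, h0', h1', rowSign, this]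
    ring
  · have := corner_y k w w'
    simp [tw, h1', h2, rowSign, this]
    ring
  · have := corner_z k w w'
    have hs : ((-1 : A) ^ k) * (-1) ^ k = 1 := by rw [← mul_pow]; simp
    simp [tw, h2, h3, rowSign, this]
    linear_combination (w k * w' (k + 1) - w (k + 1) * w' k) * (-hs)

end

section
variable {R : Type*} [CommRing R]

/-- The forms attainable by structured representations. -/
noncomputable def attain (R : Type*) [CommRing R] (k : ℕ) (hk : 4 ≤ k) :
    Submodule R (MvPolynomial (Fin 3) R) where
  carrier := {f | ∃ B : Fin 3 → Matrix (Fin (k + 2)) (Fin (k + 2)) R, (∀ s, (B s)ᵀ = - B s) ∧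
    PL k (∑ s, (X s : MvPolynomial (Fin 3) R) • (B s).map C)
      (Wp k hk (X 0) (X 1) (X 2) 0 0) = f ∧
    ∀ s, B s ⟨s, by omega⟩ ⟨s + 1, by omega⟩ = coeff (Finsupp.single s (k + 1)) f}
  add_mem' := by
    rintro f g ⟨B, hB, hf, hc⟩ ⟨B', hB', hg, hc'⟩
    refine ⟨fun s => B s + B' s, fun s => ?_, ?_, fun s => ?_⟩
    · rw [Matrix.transpose_add, hB, hB', neg_add]
    · rw [← hf, ← hg, ← PL_add, ← Finset.sum_add_distrib]
      congr 1
      refine Finset.sum_congr rfl fun s _ => ?_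
      rw [← smul_add, Matrix.map_add C (by simp)]
    · dsimp only
      rw [Matrix.add_apply, hc, hc', coeff_add]
  zero_mem' := by
    refine ⟨fun s => 0, fun s => by simp, ?_, fun s => by simp⟩
    have h : (∑ s : Fin 3, (X s : MvPolynomial (Fin 3) R) •
        (0 : Matrix (Fin (k + 2)) (Fin (k + 2)) R).map C) =
        (0 : MvPolynomial (Fin 3) R) • (0 : Matrix (Fin (k + 2)) (Fin (k + 2)) (MvPolynomial (Fin 3) R)) := by
      simp
    exact (congrArg (fun Q => PL k Q (Wp k hk (X 0) (X 1) (X 2) 0 0)) h).trans (by rw [PL_smul, zero_mul])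
  smul_mem' := by
    rintro c f ⟨B, hB, hf, hc⟩
    refine ⟨fun s => c • B s, fun s => ?_, ?_, fun s => ?_⟩
    · rw [Matrix.transpose_smul, hB, smul_neg]
    · rw [← hf, smul_eq_C_mul, ← PL_smul, Finset.smul_sum]
      congr 1
      refine Finset.sum_congr rfl fun s _ => ?_
      ext1 i j
      simp only [Matrix.smul_apply, Matrix.map_apply, smul_eq_mul, C_mul]; ring
    · dsimp only
      rw [Matrix.smul_apply, hc, coeff_smul]

lemma attain_gen (k : ℕ) (hk : 4 ≤ k) (t : Fin 3) (a b : ℕ) :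
    X t * T R k a b ∈ attain R k hk := by
  let E : Matrix (Fin (k + 2)) (Fin (k + 2)) R := Matrix.of fun i j =>
    tw k hk (e a) i * tw k hk (e b) j - tw k hk (e a) j * tw k hk (e b) i
  refine ⟨fun s => if s = t then E else 0, fun s => ?_, ?_, fun s => ?_⟩
  · dsimp only
    split_ifs
    · ext i j; simp [E]
    · simp
  · rw [Finset.sum_eq_single t]
    · dsimp only
      rw [if_pos rfl, PL_smul, T, ← det_Wp k hk,
        PL_congr k _ _ (Wp k hk (X 0) (X 1) (X 2) (tw k hk (e a)) (tw k hk (e b))), PL_det]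
      · intro i j
        have hC : ∀ (a : ℕ) (i : Fin (k + 2)),
            C (tw k hk (e a) i : R) = (tw k hk (e a) i : MvPolynomial (Fin 3) R) := by
          intro a i
          simp only [tw, C_mul, ← congrFun (C_e (R := R) a) (rowPerm k hk i)]
          simp
        simp [E, Wp, hC]
      · intro i j hj
        simp [Wp, hj]
    · intro s _ hs; simp [hs]
    · simp
  · have h1 : coeff (Finsupp.single s k) (T R k a b) =
        tw k hk (e a) ⟨s, by omega⟩ * tw k hk (e b) ⟨s + 1, by omega⟩ -
        tw k hk (e a) ⟨s + 1, by omega⟩ * tw k hk (e b) ⟨s, by omega⟩ := by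
      rw [coeff_eq_eval k _ (T_homog k a b), ← corner, T, aug_map, map_e, map_e]
      simp
    dsimp only
    rw [coeff_X_mul']
    by_cases hst : s = t
    · subst hst
      rw [if_pos rfl, if_pos (by simp)]
      rw [show Finsupp.single s (k + 1) - Finsupp.single s 1 = Finsupp.single s k by
        rw [← Finsupp.single_tsub]; simp, h1]
      simp [E]
    · rw [if_neg hst, if_neg (by simp [hst])]
      simp

lemma attain_all (k : ℕ) (hk : 4 ≤ k) (f : MvPolynomial (Fin 3) R) (hf : f.IsHomogeneous (k + 1)) :
    f ∈ attain R k hk := by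
  apply mem_of_monomials
  intro m hm
  have hd : m.degree = k + 1 := by
    by_contra h
    exact hm (hf.coeff_eq_zero h)
  obtain ⟨t, ht⟩ : ∃ t, m t ≠ 0 := by
    by_contra! h
    have : m = 0 := Finsupp.ext h
    simp [this] at hd
  have hle : Finsupp.single t 1 ≤ m := by
    rw [Finsupp.single_le_iff]; omega
  obtain ⟨m', rfl⟩ := exists_add_of_le hle
  have hd' : m'.degree = k := by
    rw [map_add, Finsupp.degree_single] at hd; omega
  have key : ∀ p ∈ Submodule.span R {p | ∃ a b, a < k + 2 ∧ b < k + 2 ∧ p = T R k a b},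
      X t * p ∈ attain R k hk := by
    intro p hp
    induction hp using Submodule.span_induction with
    | mem p hp =>
      obtain ⟨a, b, _, _, rfl⟩ := hp
      exact attain_gen k hk t a b
    | zero => simp
    | add p q _ _ hp hq => rw [mul_add]; exact Submodule.add_mem _ hp hq
    | smul c p _ hp => rw [mul_smul_comm]; exact Submodule.smul_mem _ c hp
  have := key _ (monomial_mem_span k m' hd')
  rwa [X, monomial_mul, one_mul] at this

/-- The full coefficient matrices. -/
def full (k : ℕ) (hk : 4 ≤ k) (x y z : R) (B : Matrix (Fin (k + 2)) (Fin (k + 2)) R) :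
    Matrix (Fin (2 * (k + 1))) (Fin (2 * (k + 1))) R :=
  Matrix.of fun i j =>
    if hi : i.val < k + 2 then
      if hj : j.val < k + 2 then B ⟨i, hi⟩ ⟨j, hj⟩ else Lp k hk x y z ⟨i, hi⟩ (2 * k + 1 - j)
    else
      if hj : j.val < k + 2 then - Lp k hk x y z ⟨j, hj⟩ (2 * k + 1 - i) else 0

lemma full_apply (k : ℕ) (hk : 4 ≤ k) (x y z : R) (B : Matrix (Fin (k + 2)) (Fin (k + 2)) R)
    (i j : Fin (2 * (k + 1))) (hi : i.val < k + 2) (hj : j.val < k + 2) :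
    full k hk x y z B i j = B ⟨i, hi⟩ ⟨j, hj⟩ := by
  simp [full, hi, hj]

lemma full_skew (k : ℕ) (hk : 4 ≤ k) (x y z : R) (B : Matrix (Fin (k + 2)) (Fin (k + 2)) R)
    (hB : Bᵀ = -B) : (full k hk x y z B)ᵀ = - full k hk x y z B := by
  ext i j
  have hB' : ∀ i j, B j i = - B i j := fun i j => congrFun (congrFun hB i) j
  simp only [full, Matrix.transpose_apply, Matrix.neg_apply, Matrix.of_apply]
  split_ifs
  · exact hB' _ _
  · simp
  · simp
  · simp

lemma Lp_lin (k : ℕ) (hk : 4 ≤ k) (i : Fin (k + 2)) (c : ℕ) :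
    (X 0 : MvPolynomial (Fin 3) R) * C (Lp k hk 1 0 0 i c) + X 1 * C (Lp k hk 0 1 0 i c) +
      X 2 * C (Lp k hk 0 0 1 i c) = Lp k hk (X 0) (X 1) (X 2) i c := by
  simp only [Lp, band]
  split_ifs <;> simp <;> ring

lemma coeff_lin (x y z : R) (s : Fin 3) :
    coeff (Finsupp.single s 1) ((X 0 : MvPolynomial (Fin 3) R) * C x + X 1 * C y + X 2 * C z) =
      ![x, y, z] s := by
  simp only [coeff_add, mul_comm _ (C _), coeff_C_mul, coeff_X,
    Finsupp.single_left_inj one_ne_zero]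
  fin_cases s <;> simp

end

end PfAux

open MvPolynomial Matrix

/-- Every homogeneous `f = ∑ Θ_{ijk} X₀^i X₁^j X₂^k` of degree `d`, `5 ≤ d ≤ 25`, over a
commutative ring `R` admits a linear Pfaffian `R`-representation
`M = X₀·A₀ + X₁·A₁ + X₂·A₂` whose entry `M₁₂` has `X₀`-coefficient `Θ_{d00}`, whose entry
`M₂₃` has `X₁`-coefficient `Θ_{0d0}`, whose entry `M₃₄` has `X₂`-coefficient `Θ_{00d}`, and
whose bottom-right `(d-1) × (d-1)` block (rows and columns `d+2,…,2d`, in 1-based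
numbering) is zero. -/
theorem ternary_form_admits_structured_linear_pfaffian_representation
    {R : Type*} [CommRing R] (d : ℕ) (hd5 : 5 ≤ d) (hd25 : d ≤ 25)
    (f : MvPolynomial (Fin 3) R) (hf : f.IsHomogeneous d) :
    ∃ (A₀ A₁ A₂ : Matrix (Fin (2 * d)) (Fin (2 * d)) R)
      (M : Matrix (Fin (2 * d)) (Fin (2 * d)) (MvPolynomial (Fin 3) R)),
      A₀ᵀ = -A₀ ∧ A₁ᵀ = -A₁ ∧ A₂ᵀ = -A₂ ∧
      M = (X 0 : MvPolynomial (Fin 3) R) • A₀.map C + (X 1 : MvPolynomial (Fin 3) R) • A₁.map C +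
            (X 2 : MvPolynomial (Fin 3) R) • A₂.map C ∧
      matrixPfaffian d M = f ∧
      (M ⟨0, by omega⟩ ⟨1, by omega⟩).coeff (Finsupp.single 0 1) = f.coeff (Finsupp.single 0 d) ∧
      (M ⟨1, by omega⟩ ⟨2, by omega⟩).coeff (Finsupp.single 1 1) = f.coeff (Finsupp.single 1 d) ∧
      (M ⟨2, by omega⟩ ⟨3, by omega⟩).coeff (Finsupp.single 2 1) = f.coeff (Finsupp.single 2 d) ∧
      ∀ i j : Fin (2 * d), d + 1 ≤ (i : ℕ) → (i : ℕ) < (j : ℕ) → M i j = 0 := by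
  
  obtain ⟨k, rfl⟩ : ∃ k, d = k + 1 := ⟨d - 1, by omega⟩
  have hk : 4 ≤ k := by omega
  obtain ⟨B, hB, hP, hc⟩ := PfAux.attain_all k hk f hf
  have hM : ∀ i j, ((X 0 : MvPolynomial (Fin 3) R) • (PfAux.full k hk 1 0 0 (B 0)).map C +
      (X 1 : MvPolynomial (Fin 3) R) • (PfAux.full k hk 0 1 0 (B 1)).map C +
      (X 2 : MvPolynomial (Fin 3) R) • (PfAux.full k hk 0 0 1 (B 2)).map C :
        Matrix _ _ (MvPolynomial (Fin 3) R)) i j =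
      (X 0 : MvPolynomial (Fin 3) R) * C (PfAux.full k hk 1 0 0 (B 0) i j) +
      X 1 * C (PfAux.full k hk 0 1 0 (B 1) i j) +
      X 2 * C (PfAux.full k hk 0 0 1 (B 2) i j) := fun i j => rfl
  refine ⟨PfAux.full k hk 1 0 0 (B 0), PfAux.full k hk 0 1 0 (B 1), PfAux.full k hk 0 0 1 (B 2), _,
    PfAux.full_skew _ _ _ _ _ _ (hB 0), PfAux.full_skew _ _ _ _ _ _ (hB 1),
    PfAux.full_skew _ _ _ _ _ _ (hB 2), rfl, ?_, ?_, ?_, ?_, ?_⟩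
  · rw [← hP]
    apply PfAux.pf_eq
    · intro i j hi hj
      rw [hM]
      simp [PfAux.full, hi, hj, Fin.sum_univ_three]
    · intro r j c hc hr hj
      have hr' : ¬ r.val < k + 2 := by omega
      have hcr : 2 * k + 1 - r.val = c.val := by omega
      rw [hM]
      simp only [PfAux.full, PfAux.Wp, Matrix.of_apply, hr', hj, hc, hcr, dif_pos, dif_neg,
        not_false_eq_true, if_true, ← PfAux.Lp_lin, C_neg]
      ring
    · intro r j hr hj
      rw [hM]
      simp [PfAux.full, Nat.not_lt.2 hr, Nat.not_lt.2 hj]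
  · rw [hM, PfAux.coeff_lin]
    exact (PfAux.full_apply k hk 1 0 0 (B 0) ⟨0, by omega⟩ ⟨1, by omega⟩
      (by simp; try omega) (by simp; try omega)).trans (hc 0)
  · rw [hM, PfAux.coeff_lin]
    exact (PfAux.full_apply k hk 0 1 0 (B 1) ⟨1, by omega⟩ ⟨2, by omega⟩
      (by simp; try omega) (by simp; try omega)).trans (hc 1)
  · rw [hM, PfAux.coeff_lin]
    exact (PfAux.full_apply k hk 0 0 1 (B 2) ⟨2, by omega⟩ ⟨3, by omega⟩
      (by simp; try omega) (by simp; try omega)).trans (hc 2)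
  · intro i j hi hj
    have h1 : ¬ i.val < k + 2 := by omega
    have h2 : ¬ j.val < k + 2 := by omega
    rw [hM]
    simp [PfAux.full, h1, h2]
end

section
/- Let R be a commutative ring with 1, let x, y, z denote the variables of R[x,y,z], and consider the 10×10 skew-symmetric matrix M over the polynomial ring R[x,y,z] determined by the following upper-triangular entries (all other upper entries are obtained by the listed pattern and the lower entries by skew-symmetry): M₁₂ = Θ₁x + b₁y + c₁z, M₁₃ = m₂, M₁₄ = m₃, M₁₅ = m₄, M₁₆ = m₅, M₁₇ = −y, M₁₈ = −z, M₁₉ = M₁,₁₀ = 0; M₂₃ = a₁₀x + Θ₂y + c₁₀z, M₂₄ = m₁₁, M₂₅ = m₁₂, M₂₆ = m₁₃, M₂₇ = −z, M₂₈ = M₂₉ = M₂,₁₀ = 0; M₃₄ = a₁₈x + b₁₈y + Θ₃z, M₃₅ = m₁₉, M₃₆ = m₂₀, M₃₇ = M₃₈ = M₃₉ = 0, M₃,₁₀ = x; M₄₅ = m₂₅, M₄₆ = m₂₆, M₄₇ = M₄₈ = 0, M₄₉ = x, M₄,₁₀ = −y; M₅₆ = m₃₁, M₅₇ = 0, M₅₈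 = x, M₅₉ = −y, M₅,₁₀ = −z; M₆₇ = x, M₆₈ = y, M₆₉ = −z, M₆,₁₀ = 0; M_{ij} = 0 for 7 ≤ i < j ≤ 10; here m_r := a_r x + b_r y + c_r z, and Θ₁, Θ₂, Θ₃ and all the a_r, b_r, c_r are arbitrary elements of R. Then Pf(M) = x⁵Θ₁ + y⁵Θ₂ + z⁵Θ₃ + x⁴y(b₁ − a₁₃) + x³y²(a₁₂ − b₁₃) + x²y³(a₁₁ + b₁₂) + xy⁴(a₁₀ + b₁₁) + x⁴z(−a₁₂ + c₁ + a₅) + x³z²(a₃ − a₁₀ − c₁₂ + a₃₁ + c₅) + x²z³(c₃ − c₁₀ + a₂₀ − a₂₅ + c₃₁) + xz⁴(c₂₀ + a₁₈ − c₂₅) + y⁴z(−b₂ + c₁₀) + y³z²(b₂₀ − c₂) + y²z³(c₂₀ − b₁₉) + yz⁴(−c₁₉ + b₁₈) + xyz³(−a₁₉ + c₂₆ + b₂₀ − b₂₅) + xy²z²(−c₁₀ − c₃ + b₂₆ + a₂₀) + xy³z(−b₃ + c₁₁ − Θ₂ − a₂) + x²yz²(−Θ₂ − 2c₁₁ + b₃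 + a₂₆ + b₃₁ − c₄) + x²y²z(−2b₁₁ + c₁₂ − a₁₀ − a₃ − b₄) + x³yz(−c₁₃ + b₅ − a₄ − b₁₂ − 2a₁₁). -/
open MvPolynomial Matrix

set_option maxHeartbeats 3200000

theorem pf_succ {S : Type*} [CommRing S] (n : ℕ)
    (M : Matrix (Fin (2 * (n + 1))) (Fin (2 * (n + 1))) S) :
    matrixPfaffian (n + 1) M = ∑ j : Fin (2 * n + 1),
        (-1 : S) ^ ((j : ℕ) + 1) * M (Fin.last (2 * n + 1)) j.castSucc *
          matrixPfaffian n
            (fun a b => M ((j.succAbove a).castSucc) ((j.succAbove b).castSucc)) := by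
  rw [matrixPfaffian]

theorem sum_nine {S : Type*} [AddCommMonoid S] (f : Fin 9 → S) :
    ∑ i, f i = f 0 + f 1 + f 2 + f 3 + f 4 + f 5 + f 6 + f 7 + f 8 := by
  rw [Fin.sum_univ_castSucc, Fin.sum_univ_eight]
  rfl

/-- Expansion of a `2 × 2` Pfaffian along the last row. -/
theorem pf_expand_2 {S ι : Type*} [CommRing S] (f : ι → ι → S) (v0 v1 : ι) :
    matrixPfaffian 1 (fun a b => f (![v0, v1] a) (![v0, v1] b)) =
      0 - f v1 v0 := by
  have key : ∀ j : Fin 1, ∀ w : Fin 0 → ι,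
      (∀ a, ![v0, v1] ((j.succAbove a).castSucc) = w a) →
      matrixPfaffian 0 (fun a b => f (![v0, v1] ((j.succAbove a).castSucc))
        (![v0, v1] ((j.succAbove b).castSucc))) = matrixPfaffian 0 (fun a b => f (w a) (w b)) := by
    intro j w hw
    congr 1
    funext a b
    rw [hw, hw]
  refine (pf_succ 0 _).trans ?_
  refine (Fin.sum_univ_one _).trans ?_
  rw [key 0 ![] (by intro a; fin_cases a <;> rfl)]
  simp only [matrixPfaffian]
  simp [Fin.last, Fin.castSucc, Fin.castAdd, Fin.castLE]
  try ring

/-- Expansion of a `4 × 4` Pfaffian along the last row. -/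
theorem pf_expand_4 {S ι : Type*} [CommRing S] (f : ι → ι → S) (v0 v1 v2 v3 : ι) :
    matrixPfaffian 2 (fun a b => f (![v0, v1, v2, v3] a) (![v0, v1, v2, v3] b)) =
      0 - f v3 v0 * matrixPfaffian 1 (fun a b => f (![v1, v2] a) (![v1, v2] b))
        + f v3 v1 * matrixPfaffian 1 (fun a b => f (![v0, v2] a) (![v0, v2] b))
        - f v3 v2 * matrixPfaffian 1 (fun a b => f (![v0, v1] a) (![v0, v1] b)) := by
  have key : ∀ j : Fin 3, ∀ w : Fin 2 → ι,
      (∀ a, ![v0, v1, v2, v3] ((j.succAbove a).castSucc) = w a) →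
      matrixPfaffian 1 (fun a b => f (![v0, v1, v2, v3] ((j.succAbove a).castSucc))
        (![v0, v1, v2, v3] ((j.succAbove b).castSucc))) = matrixPfaffian 1 (fun a b => f (w a) (w b)) := by
    intro j w hw
    congr 1
    funext a b
    rw [hw, hw]
  refine (pf_succ 1 _).trans ?_
  refine (Fin.sum_univ_three _).trans ?_
  rw [key 0 ![v1, v2] (by intro a; fin_cases a <;> rfl)]
  rw [key 1 ![v0, v2] (by intro a; fin_cases a <;> rfl)]
  rw [key 2 ![v0, v1] (by intro a; fin_cases a <;> rfl)]
  simp [Fin.last, Fin.castSucc, Fin.castAdd, Fin.castLE]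
  try ring

/-- Expansion of a `6 × 6` Pfaffian along the last row. -/
theorem pf_expand_6 {S ι : Type*} [CommRing S] (f : ι → ι → S) (v0 v1 v2 v3 v4 v5 : ι) :
    matrixPfaffian 3 (fun a b => f (![v0, v1, v2, v3, v4, v5] a) (![v0, v1, v2, v3, v4, v5] b)) =
      0 - f v5 v0 * matrixPfaffian 2 (fun a b => f (![v1, v2, v3, v4] a) (![v1, v2, v3, v4] b))
        + f v5 v1 * matrixPfaffian 2 (fun a b => f (![v0, v2, v3, v4] a) (![v0, v2, v3, v4] b))
        - f v5 v2 * matrixPfaffian 2 (fun a b => f (![v0, v1, v3, v4] a) (![v0, v1, v3, v4] b))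
        + f v5 v3 * matrixPfaffian 2 (fun a b => f (![v0, v1, v2, v4] a) (![v0, v1, v2, v4] b))
        - f v5 v4 * matrixPfaffian 2 (fun a b => f (![v0, v1, v2, v3] a) (![v0, v1, v2, v3] b)) := by
  have key : ∀ j : Fin 5, ∀ w : Fin 4 → ι,
      (∀ a, ![v0, v1, v2, v3, v4, v5] ((j.succAbove a).castSucc) = w a) →
      matrixPfaffian 2 (fun a b => f (![v0, v1, v2, v3, v4, v5] ((j.succAbove a).castSucc))
        (![v0, v1, v2, v3, v4, v5] ((j.succAbove b).castSucc))) = matrixPfaffian 2 (fun a b => f (w a) (w b)) := by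
    intro j w hw
    congr 1
    funext a b
    rw [hw, hw]
  refine (pf_succ 2 _).trans ?_
  refine (Fin.sum_univ_five _).trans ?_
  rw [key 0 ![v1, v2, v3, v4] (by intro a; fin_cases a <;> rfl)]
  rw [key 1 ![v0, v2, v3, v4] (by intro a; fin_cases a <;> rfl)]
  rw [key 2 ![v0, v1, v3, v4] (by intro a; fin_cases a <;> rfl)]
  rw [key 3 ![v0, v1, v2, v4] (by intro a; fin_cases a <;> rfl)]
  rw [key 4 ![v0, v1, v2, v3] (by intro a; fin_cases a <;> rfl)]
  simp [Fin.last, Fin.castSucc, Fin.castAdd, Fin.castLE]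
  try ring

/-- Expansion of a `8 × 8` Pfaffian along the last row. -/
theorem pf_expand_8 {S ι : Type*} [CommRing S] (f : ι → ι → S) (v0 v1 v2 v3 v4 v5 v6 v7 : ι) :
    matrixPfaffian 4 (fun a b => f (![v0, v1, v2, v3, v4, v5, v6, v7] a) (![v0, v1, v2, v3, v4, v5, v6, v7] b)) =
      0 - f v7 v0 * matrixPfaffian 3 (fun a b => f (![v1, v2, v3, v4, v5, v6] a) (![v1, v2, v3, v4, v5, v6] b))
        + f v7 v1 * matrixPfaffian 3 (fun a b => f (![v0, v2, v3, v4, v5, v6] a) (![v0, v2, v3, v4, v5, v6] b))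
        - f v7 v2 * matrixPfaffian 3 (fun a b => f (![v0, v1, v3, v4, v5, v6] a) (![v0, v1, v3, v4, v5, v6] b))
        + f v7 v3 * matrixPfaffian 3 (fun a b => f (![v0, v1, v2, v4, v5, v6] a) (![v0, v1, v2, v4, v5, v6] b))
        - f v7 v4 * matrixPfaffian 3 (fun a b => f (![v0, v1, v2, v3, v5, v6] a) (![v0, v1, v2, v3, v5, v6] b))
        + f v7 v5 * matrixPfaffian 3 (fun a b => f (![v0, v1, v2, v3, v4, v6] a) (![v0, v1, v2, v3, v4, v6] b))
        - f v7 v6 * matrixPfaffian 3 (fun a b => f (![v0, v1, v2, v3, v4, v5] a) (![v0, v1, v2, v3, v4, v5] b)) := by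
  have key : ∀ j : Fin 7, ∀ w : Fin 6 → ι,
      (∀ a, ![v0, v1, v2, v3, v4, v5, v6, v7] ((j.succAbove a).castSucc) = w a) →
      matrixPfaffian 3 (fun a b => f (![v0, v1, v2, v3, v4, v5, v6, v7] ((j.succAbove a).castSucc))
        (![v0, v1, v2, v3, v4, v5, v6, v7] ((j.succAbove b).castSucc))) = matrixPfaffian 3 (fun a b => f (w a) (w b)) := by
    intro j w hw
    congr 1
    funext a b
    rw [hw, hw]
  refine (pf_succ 3 _).trans ?_
  refine (Fin.sum_univ_seven _).trans ?_
  rw [key 0 ![v1, v2, v3, v4, v5, v6] (by intro a; fin_cases a <;> rfl)]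
  rw [key 1 ![v0, v2, v3, v4, v5, v6] (by intro a; fin_cases a <;> rfl)]
  rw [key 2 ![v0, v1, v3, v4, v5, v6] (by intro a; fin_cases a <;> rfl)]
  rw [key 3 ![v0, v1, v2, v4, v5, v6] (by intro a; fin_cases a <;> rfl)]
  rw [key 4 ![v0, v1, v2, v3, v5, v6] (by intro a; fin_cases a <;> rfl)]
  rw [key 5 ![v0, v1, v2, v3, v4, v6] (by intro a; fin_cases a <;> rfl)]
  rw [key 6 ![v0, v1, v2, v3, v4, v5] (by intro a; fin_cases a <;> rfl)]
  simp [Fin.last, Fin.castSucc, Fin.castAdd, Fin.castLE]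
  try ring

/-- Expansion of a `10 × 10` Pfaffian along the last row. -/
theorem pf_expand_10 {S ι : Type*} [CommRing S] (f : ι → ι → S) (v0 v1 v2 v3 v4 v5 v6 v7 v8 v9 : ι) :
    matrixPfaffian 5 (fun a b => f (![v0, v1, v2, v3, v4, v5, v6, v7, v8, v9] a) (![v0, v1, v2, v3, v4, v5, v6, v7, v8, v9] b)) =
      0 - f v9 v0 * matrixPfaffian 4 (fun a b => f (![v1, v2, v3, v4, v5, v6, v7, v8] a) (![v1, v2, v3, v4, v5, v6, v7, v8] b))
        + f v9 v1 * matrixPfaffian 4 (fun a b => f (![v0, v2, v3, v4, v5, v6, v7, v8] a) (![v0, v2, v3, v4, v5, v6, v7, v8] b))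
        - f v9 v2 * matrixPfaffian 4 (fun a b => f (![v0, v1, v3, v4, v5, v6, v7, v8] a) (![v0, v1, v3, v4, v5, v6, v7, v8] b))
        + f v9 v3 * matrixPfaffian 4 (fun a b => f (![v0, v1, v2, v4, v5, v6, v7, v8] a) (![v0, v1, v2, v4, v5, v6, v7, v8] b))
        - f v9 v4 * matrixPfaffian 4 (fun a b => f (![v0, v1, v2, v3, v5, v6, v7, v8] a) (![v0, v1, v2, v3, v5, v6, v7, v8] b))
        + f v9 v5 * matrixPfaffian 4 (fun a b => f (![v0, v1, v2, v3, v4, v6, v7, v8] a) (![v0, v1, v2, v3, v4, v6, v7, v8] b))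
        - f v9 v6 * matrixPfaffian 4 (fun a b => f (![v0, v1, v2, v3, v4, v5, v7, v8] a) (![v0, v1, v2, v3, v4, v5, v7, v8] b))
        + f v9 v7 * matrixPfaffian 4 (fun a b => f (![v0, v1, v2, v3, v4, v5, v6, v8] a) (![v0, v1, v2, v3, v4, v5, v6, v8] b))
        - f v9 v8 * matrixPfaffian 4 (fun a b => f (![v0, v1, v2, v3, v4, v5, v6, v7] a) (![v0, v1, v2, v3, v4, v5, v6, v7] b)) := by
  have key : ∀ j : Fin 9, ∀ w : Fin 8 → ι,
      (∀ a, ![v0, v1, v2, v3, v4, v5, v6, v7, v8, v9] ((j.succAbove a).castSucc) = w a) →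
      matrixPfaffian 4 (fun a b => f (![v0, v1, v2, v3, v4, v5, v6, v7, v8, v9] ((j.succAbove a).castSucc))
        (![v0, v1, v2, v3, v4, v5, v6, v7, v8, v9] ((j.succAbove b).castSucc))) = matrixPfaffian 4 (fun a b => f (w a) (w b)) := by
    intro j w hw
    congr 1
    funext a b
    rw [hw, hw]
  refine (pf_succ 4 _).trans ?_
  refine (sum_nine _).trans ?_
  rw [key 0 ![v1, v2, v3, v4, v5, v6, v7, v8] (by intro a; fin_cases a <;> rfl)]
  rw [key 1 ![v0, v2, v3, v4, v5, v6, v7, v8] (by intro a; fin_cases a <;> rfl)]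
  rw [key 2 ![v0, v1, v3, v4, v5, v6, v7, v8] (by intro a; fin_cases a <;> rfl)]
  rw [key 3 ![v0, v1, v2, v4, v5, v6, v7, v8] (by intro a; fin_cases a <;> rfl)]
  rw [key 4 ![v0, v1, v2, v3, v5, v6, v7, v8] (by intro a; fin_cases a <;> rfl)]
  rw [key 5 ![v0, v1, v2, v3, v4, v6, v7, v8] (by intro a; fin_cases a <;> rfl)]
  rw [key 6 ![v0, v1, v2, v3, v4, v5, v7, v8] (by intro a; fin_cases a <;> rfl)]
  rw [key 7 ![v0, v1, v2, v3, v4, v5, v6, v8] (by intro a; fin_cases a <;> rfl)]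
  rw [key 8 ![v0, v1, v2, v3, v4, v5, v6, v7] (by intro a; fin_cases a <;> rfl)]
  simp [Fin.last, Fin.castSucc, Fin.castAdd, Fin.castLE]
  try ring

/-- The Pfaffian of the `10 × 10` skew-symmetric template matrix of Example 2.3,
computed explicitly. Here `x = X 0`, `y = X 1`, `z = X 2`, `mᵣ = aᵣx + bᵣy + cᵣz`, and
`Θ₁, Θ₂, Θ₃, aᵣ, bᵣ, cᵣ` are arbitrary elements of `R`. -/
theorem pfaffian_of_quintic_template_matrix {R : Type*} [CommRing R]
    (Θ₁ Θ₂ Θ₃ b₁ c₁ a₂ b₂ c₂ a₃ b₃ c₃ a₄ b₄ c₄ a₅ b₅ c₅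
      a₁₀ c₁₀ a₁₁ b₁₁ c₁₁ a₁₂ b₁₂ c₁₂ a₁₃ b₁₃ c₁₃ a₁₈ b₁₈ a₁₉ b₁₉ c₁₉
      a₂₀ b₂₀ c₂₀ a₂₅ b₂₅ c₂₅ a₂₆ b₂₆ c₂₆ a₃₁ b₃₁ c₃₁ : R)
    (M : Matrix (Fin (2 * 5)) (Fin (2 * 5)) (MvPolynomial (Fin 3) R))
    (hM : M =
      !![0, C Θ₁ * X 0 + C b₁ * X 1 + C c₁ * X 2, C a₂ * X 0 + C b₂ * X 1 + C c₂ * X 2, C a₃ * X 0 + C b₃ * X 1 + C c₃ * X 2, C a₄ * X 0 + C b₄ * X 1 + C c₄ * X 2, C a₅ * X 0 + C b₅ * X 1 + C c₅ * X 2, -X 1, -X 2, 0, 0;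
        -(C Θ₁ * X 0 + C b₁ * X 1 + C c₁ * X 2), 0, C a₁₀ * X 0 + C Θ₂ * X 1 + C c₁₀ * X 2, C a₁₁ * X 0 + C b₁₁ * X 1 + C c₁₁ * X 2, C a₁₂ * X 0 + C b₁₂ * X 1 + C c₁₂ * X 2, C a₁₃ * X 0 + C b₁₃ * X 1 + C c₁₃ * X 2, -X 2, 0, 0, 0;
        -(C a₂ * X 0 + C b₂ * X 1 + C c₂ * X 2), -(C a₁₀ * X 0 + C Θ₂ * X 1 + C c₁₀ * X 2), 0, C a₁₈ * X 0 + C b₁₈ * X 1 + C Θ₃ * X 2, C a₁₉ * X 0 + C b₁₉ * X 1 + C c₁₉ * X 2, C a₂₀ * X 0 + C b₂₀ * X 1 + C c₂₀ * X 2, 0, 0, 0, X 0;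
        -(C a₃ * X 0 + C b₃ * X 1 + C c₃ * X 2), -(C a₁₁ * X 0 + C b₁₁ * X 1 + C c₁₁ * X 2), -(C a₁₈ * X 0 + C b₁₈ * X 1 + C Θ₃ * X 2), 0, C a₂₅ * X 0 + C b₂₅ * X 1 + C c₂₅ * X 2, C a₂₆ * X 0 + C b₂₆ * X 1 + C c₂₆ * X 2, 0, 0, X 0, -X 1;
        -(C a₄ * X 0 + C b₄ * X 1 + C c₄ * X 2), -(C a₁₂ * X 0 + C b₁₂ * X 1 + C c₁₂ * X 2), -(C a₁₉ * X 0 + C b₁₉ * X 1 + C c₁₉ * X 2), -(C a₂₅ * X 0 + C b₂₅ * X 1 + C c₂₅ * X 2), 0, C a₃₁ * X 0 + C b₃₁ * X 1 + C c₃₁ * X 2, 0, X 0, -X 1, -X 2;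
        -(C a₅ * X 0 + C b₅ * X 1 + C c₅ * X 2), -(C a₁₃ * X 0 + C b₁₃ * X 1 + C c₁₃ * X 2), -(C a₂₀ * X 0 + C b₂₀ * X 1 + C c₂₀ * X 2), -(C a₂₆ * X 0 + C b₂₆ * X 1 + C c₂₆ * X 2), -(C a₃₁ * X 0 + C b₃₁ * X 1 + C c₃₁ * X 2), 0, X 0, X 1, -X 2, 0;
        -(-X 1), -(-X 2), 0, 0, 0, -(X 0), 0, 0, 0, 0;
        -(-X 2), 0, 0, 0, -(X 0), -(X 1), 0, 0, 0, 0;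
        0, 0, 0, -(X 0), -(-X 1), -(-X 2), 0, 0, 0, 0;
        0, 0, -(X 0), -(-X 1), -(-X 2), 0, 0, 0, 0, 0]) :
    matrixPfaffian 5 M =
      X 0 ^ 5 * C (Θ₁) +
      X 1 ^ 5 * C (Θ₂) +
      X 2 ^ 5 * C (Θ₃) +
      X 0 ^ 4 * X 1 * C (b₁ - a₁₃) +
      X 0 ^ 3 * X 1 ^ 2 * C (a₁₂ - b₁₃) +
      X 0 ^ 2 * X 1 ^ 3 * C (a₁₁ + b₁₂) +
      X 0 * X 1 ^ 4 * C (a₁₀ + b₁₁) +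
      X 0 ^ 4 * X 2 * C (-a₁₂ + c₁ + a₅) +
      X 0 ^ 3 * X 2 ^ 2 * C (a₃ - a₁₀ - c₁₂ + a₃₁ + c₅) +
      X 0 ^ 2 * X 2 ^ 3 * C (c₃ - c₁₀ + a₂₀ - a₂₅ + c₃₁) +
      X 0 * X 2 ^ 4 * C (c₂₀ + a₁₈ - c₂₅) +
      X 1 ^ 4 * X 2 * C (-b₂ + c₁₀) +
      X 1 ^ 3 * X 2 ^ 2 * C (b₂₀ - c₂) +
      X 1 ^ 2 * X 2 ^ 3 * C (c₂₀ - b₁₉) +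
      X 1 * X 2 ^ 4 * C (-c₁₉ + b₁₈) +
      X 0 * X 1 * X 2 ^ 3 * C (-a₁₉ + c₂₆ + b₂₀ - b₂₅) +
      X 0 * X 1 ^ 2 * X 2 ^ 2 * C (-c₁₀ - c₃ + b₂₆ + a₂₀) +
      X 0 * X 1 ^ 3 * X 2 * C (-b₃ + c₁₁ - Θ₂ - a₂) +
      X 0 ^ 2 * X 1 * X 2 ^ 2 * C (-Θ₂ - 2 * c₁₁ + b₃ + a₂₆ + b₃₁ - c₄) +
      X 0 ^ 2 * X 1 ^ 2 * X 2 * C (-(2 * b₁₁) + c₁₂ - a₁₀ - a₃ - b₄) +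
      X 0 ^ 3 * X 1 * X 2 * C (-c₁₃ + b₅ - a₄ - b₁₂ - 2 * a₁₁) := by
  obtain ⟨f, hf⟩ : ∃ f : Fin 10 → Fin 10 → MvPolynomial (Fin 3) R, f = M := ⟨M, rfl⟩
  have h9_0 : f 9 0 = 0 := by rw [hf, hM]; rfl
  have h9_1 : f 9 1 = 0 := by rw [hf, hM]; rfl
  have h9_2 : f 9 2 = -(X 0) := by rw [hf, hM]; rfl
  have h9_3 : f 9 3 = -(-X 1) := by rw [hf, hM]; rfl
  have h9_4 : f 9 4 = -(-X 2) := by rw [hf, hM]; rfl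
  have h9_5 : f 9 5 = 0 := by rw [hf, hM]; rfl
  have h9_6 : f 9 6 = 0 := by rw [hf, hM]; rfl
  have h9_7 : f 9 7 = 0 := by rw [hf, hM]; rfl
  have h9_8 : f 9 8 = 0 := by rw [hf, hM]; rfl
  have h8_0 : f 8 0 = 0 := by rw [hf, hM]; rfl
  have h8_1 : f 8 1 = 0 := by rw [hf, hM]; rfl
  have h8_2 : f 8 2 = 0 := by rw [hf, hM]; rfl
  have h8_3 : f 8 3 = -(X 0) := by rw [hf, hM]; rfl
  have h8_4 : f 8 4 = -(-X 1) := by rw [hf, hM]; rfl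
  have h8_5 : f 8 5 = -(-X 2) := by rw [hf, hM]; rfl
  have h8_6 : f 8 6 = 0 := by rw [hf, hM]; rfl
  have h8_7 : f 8 7 = 0 := by rw [hf, hM]; rfl
  have h7_0 : f 7 0 = -(-X 2) := by rw [hf, hM]; rfl
  have h7_1 : f 7 1 = 0 := by rw [hf, hM]; rfl
  have h7_2 : f 7 2 = 0 := by rw [hf, hM]; rfl
  have h7_3 : f 7 3 = 0 := by rw [hf, hM]; rfl
  have h7_4 : f 7 4 = -(X 0) := by rw [hf, hM]; rfl
  have h7_5 : f 7 5 = -(X 1) := by rw [hf, hM]; rfl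
  have h7_6 : f 7 6 = 0 := by rw [hf, hM]; rfl
  have h6_0 : f 6 0 = -(-X 1) := by rw [hf, hM]; rfl
  have h6_1 : f 6 1 = -(-X 2) := by rw [hf, hM]; rfl
  have h6_2 : f 6 2 = 0 := by rw [hf, hM]; rfl
  have h6_3 : f 6 3 = 0 := by rw [hf, hM]; rfl
  have h6_4 : f 6 4 = 0 := by rw [hf, hM]; rfl
  have h6_5 : f 6 5 = -(X 0) := by rw [hf, hM]; rfl
  have h5_0 : f 5 0 = -(C a₅ * X 0 + C b₅ * X 1 + C c₅ * X 2) := by rw [hf, hM]; rfl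
  have h5_1 : f 5 1 = -(C a₁₃ * X 0 + C b₁₃ * X 1 + C c₁₃ * X 2) := by rw [hf, hM]; rfl
  have h5_2 : f 5 2 = -(C a₂₀ * X 0 + C b₂₀ * X 1 + C c₂₀ * X 2) := by rw [hf, hM]; rfl
  have h5_3 : f 5 3 = -(C a₂₆ * X 0 + C b₂₆ * X 1 + C c₂₆ * X 2) := by rw [hf, hM]; rfl
  have h5_4 : f 5 4 = -(C a₃₁ * X 0 + C b₃₁ * X 1 + C c₃₁ * X 2) := by rw [hf, hM]; rfl
  have h4_0 : f 4 0 = -(C a₄ * X 0 + C b₄ * X 1 + C c₄ * X 2) := by rw [hf, hM]; rfl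
  have h4_1 : f 4 1 = -(C a₁₂ * X 0 + C b₁₂ * X 1 + C c₁₂ * X 2) := by rw [hf, hM]; rfl
  have h4_2 : f 4 2 = -(C a₁₉ * X 0 + C b₁₉ * X 1 + C c₁₉ * X 2) := by rw [hf, hM]; rfl
  have h4_3 : f 4 3 = -(C a₂₅ * X 0 + C b₂₅ * X 1 + C c₂₅ * X 2) := by rw [hf, hM]; rfl
  have h3_0 : f 3 0 = -(C a₃ * X 0 + C b₃ * X 1 + C c₃ * X 2) := by rw [hf, hM]; rfl
  have h3_1 : f 3 1 = -(C a₁₁ * X 0 + C b₁₁ * X 1 + C c₁₁ * X 2) := by rw [hf, hM]; rfl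
  have h3_2 : f 3 2 = -(C a₁₈ * X 0 + C b₁₈ * X 1 + C Θ₃ * X 2) := by rw [hf, hM]; rfl
  have h2_0 : f 2 0 = -(C a₂ * X 0 + C b₂ * X 1 + C c₂ * X 2) := by rw [hf, hM]; rfl
  have h2_1 : f 2 1 = -(C a₁₀ * X 0 + C Θ₂ * X 1 + C c₁₀ * X 2) := by rw [hf, hM]; rfl
  have h1_0 : f 1 0 = -(C Θ₁ * X 0 + C b₁ * X 1 + C c₁ * X 2) := by rw [hf, hM]; rfl
  have hv : ∀ a : Fin 10, (![0, 1, 2, 3, 4, 5, 6, 7, 8, 9] : Fin 10 → Fin 10) a = a := by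
    intro a; fin_cases a <;> rfl
  have e : matrixPfaffian 5 M = matrixPfaffian 5 (fun a b => f ((![0, 1, 2, 3, 4, 5, 6, 7, 8, 9] : Fin 10 → Fin 10) a)
      ((![0, 1, 2, 3, 4, 5, 6, 7, 8, 9] : Fin 10 → Fin 10) b)) := by
    rw [← hf]
    congr 1
    funext a b
    exact (congrArg₂ f (hv a) (hv b)).symm
  refine e.trans ?_
  clear e hv hf hM
  refine (pf_expand_10 f 0 1 2 3 4 5 6 7 8 9).trans ?_
  simp only [h9_0, h9_1, h9_2, h9_3, h9_4, h9_5, h9_6, h9_7, h9_8, zero_mul, neg_neg, add_zero, zero_add, sub_zero, zero_sub]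
  simp only [pf_expand_8]
  simp only [h8_0, h8_1, h8_2, h8_3, h8_4, h8_5, h8_6, h8_7, zero_mul, neg_neg, add_zero, zero_add, sub_zero, zero_sub]
  simp only [pf_expand_6]
  simp only [h7_0, h7_1, h7_2, h7_3, h7_4, h7_5, h7_6, zero_mul, neg_neg, add_zero, zero_add, sub_zero, zero_sub]
  simp only [pf_expand_4]
  simp only [h6_0, h6_1, h6_2, h6_3, h6_4, h6_5, zero_mul, neg_neg, add_zero, zero_add, sub_zero, zero_sub]
  simp only [pf_expand_2, h5_0, h5_1, h5_2, h5_3, h5_4, h4_0, h4_1, h4_2, h4_3, h3_0, h3_1, h3_2, h2_0, h2_1, h1_0]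
  simp only [map_add, map_sub, map_neg, map_mul, map_ofNat]
  ring
end

section
/- Let R be a commutative ring with 1 and let f ∈ R[x,y,z] be an arbitrary homogeneous polynomial of degree 5, with coefficients written as f = x⁵Θ₁ + y⁵Θ₂ + z⁵Θ₃ + x⁴yΘ₄ + x³y²Θ₅ + x²y³Θ₆ + xy⁴Θ₇ + x⁴zΘ₈ + x³z²Θ₉ + x²z³Θ₁₀ + xz⁴Θ₁₁ + y⁴zΘ₁₂ + y³z²Θ₁₃ + y²z³Θ₁₄ + yz⁴Θ₁₅ + xyz³Θ₁₆ + xy²z²Θ₁₇ + xy³zΘ₁₈ + x²yz²Θ₁₉ + x²y²zΘ₂₀ + x³yzΘ₂₁. Then there exists a 10×10 skew-symmetric matrix M over R[x,y,z], whose every entry is an R-linear combination of x, y, z, such that Pf(M) = f and such that M has the shape of Example 2.3: the entry M₁₂ has x-coefficient Θ₁, M₂₃ has y-coefficient Θ₂, M₃₄ has z-coefficient Θ₃; M₁₇ = −y, M₁₈ = −z, M₁₉ = M₁,₁₀ = 0; M₂₇ = −z, M₂₈ = M₂₉ = M₂,₁₀ = 0; M₃₇ = M₃₈ = M₃₉ =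 0, M₃,₁₀ = x; M₄₇ = M₄₈ = 0, M₄₉ = x, M₄,₁₀ = −y; M₅₇ = 0, M₅₈ = x, M₅₉ = −y, M₅,₁₀ = −z; M₆₇ = x, M₆₈ = y, M₆₉ = −z, M₆,₁₀ = 0; and M_{ij} = 0 for all 7 ≤ i < j ≤ 10. -/
open MvPolynomial Matrix

set_option maxHeartbeats 1600000

set_option linter.all false

/-- The Pfaffian of size 4, with the index type in normal form. -/
def pfa2 {S : Type*} [CommRing S] (M : Fin 4 → Fin 4 → S) : S :=
  matrixPfaffian 2 M

/-- The Pfaffian of size 6, with the index type in normal form. -/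
def pfa3 {S : Type*} [CommRing S] (M : Fin 6 → Fin 6 → S) : S :=
  matrixPfaffian 3 M

/-- The Pfaffian of size 8, with the index type in normal form. -/
def pfa4 {S : Type*} [CommRing S] (M : Fin 8 → Fin 8 → S) : S :=
  matrixPfaffian 4 M

/-- The Pfaffian of size 10, with the index type in normal form. -/
def pfa5 {S : Type*} [CommRing S] (M : Fin 10 → Fin 10 → S) : S :=
  matrixPfaffian 5 M

theorem pf_two {S : Type*} [CommRing S] (M : Fin 4 → Fin 4 → S) :
    pfa2 M = M 3 0 * M 2 1 - M 3 1 * M 2 0 + M 3 2 * M 1 0 := by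
  simp [pfa2, matrixPfaffian, Fin.sum_univ_succ, Fin.succAbove]
  ring

theorem pf_step3 {S : Type*} [CommRing S] (M : Fin 6 → Fin 6 → S) :
    pfa3 M =
      - M 5 0 * pfa2 (fun a b : Fin 4 =>
          M ((![1, 2, 3, 4] : Fin 4 → Fin 6) a)
            ((![1, 2, 3, 4] : Fin 4 → Fin 6) b))
      + M 5 1 * pfa2 (fun a b : Fin 4 =>
          M ((![0, 2, 3, 4] : Fin 4 → Fin 6) a)
            ((![0, 2, 3, 4] : Fin 4 → Fin 6) b))
      - M 5 2 * pfa2 (fun a b : Fin 4 =>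
          M ((![0, 1, 3, 4] : Fin 4 → Fin 6) a)
            ((![0, 1, 3, 4] : Fin 4 → Fin 6) b))
      + M 5 3 * pfa2 (fun a b : Fin 4 =>
          M ((![0, 1, 2, 4] : Fin 4 → Fin 6) a)
            ((![0, 1, 2, 4] : Fin 4 → Fin 6) b))
      - M 5 4 * pfa2 (fun a b : Fin 4 =>
          M ((![0, 1, 2, 3] : Fin 4 → Fin 6) a)
            ((![0, 1, 2, 3] : Fin 4 → Fin 6) b)) := by
  have h : ∀ (j : Fin 5) (v : Fin 4 → Fin 6), (∀ a, (j.succAbove a).castSucc = v a) →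
      (fun a b : Fin 4 => M ((j.succAbove a).castSucc) ((j.succAbove b).castSucc)) =
        fun a b => M (v a) (v b) := by
    intro j v hv
    funext a b
    rw [hv, hv]
  rw [← h 0 (![1, 2, 3, 4] : Fin 4 → Fin 6) (by decide)]
  rw [← h 1 (![0, 2, 3, 4] : Fin 4 → Fin 6) (by decide)]
  rw [← h 2 (![0, 1, 3, 4] : Fin 4 → Fin 6) (by decide)]
  rw [← h 3 (![0, 1, 2, 4] : Fin 4 → Fin 6) (by decide)]
  rw [← h 4 (![0, 1, 2, 3] : Fin 4 → Fin 6) (by decide)]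
  refine Eq.trans (show pfa3 M = ∑ j : Fin 5, (-1 : S) ^ ((j : ℕ) + 1) *
      M (Fin.last 5) j.castSucc * pfa2 (fun a b : Fin 4 =>
        M ((j.succAbove a).castSucc) ((j.succAbove b).castSucc)) from rfl) ?_
  refine (Fin.sum_univ_five _).trans ?_
  change (-1) ^ 1 * M 5 0 * pfa2 _ + (-1) ^ 2 * M 5 1 * pfa2 _ + (-1) ^ 3 * M 5 2 * pfa2 _ + (-1) ^ 4 * M 5 3 * pfa2 _ + (-1) ^ 5 * M 5 4 * pfa2 _ = _
  ring

theorem pf_step4 {S : Type*} [CommRing S] (M : Fin 8 → Fin 8 → S) :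
    pfa4 M =
      - M 7 0 * pfa3 (fun a b : Fin 6 =>
          M ((![1, 2, 3, 4, 5, 6] : Fin 6 → Fin 8) a)
            ((![1, 2, 3, 4, 5, 6] : Fin 6 → Fin 8) b))
      + M 7 1 * pfa3 (fun a b : Fin 6 =>
          M ((![0, 2, 3, 4, 5, 6] : Fin 6 → Fin 8) a)
            ((![0, 2, 3, 4, 5, 6] : Fin 6 → Fin 8) b))
      - M 7 2 * pfa3 (fun a b : Fin 6 =>
          M ((![0, 1, 3, 4, 5, 6] : Fin 6 → Fin 8) a)
            ((![0, 1, 3, 4, 5, 6] : Fin 6 → Fin 8) b))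
      + M 7 3 * pfa3 (fun a b : Fin 6 =>
          M ((![0, 1, 2, 4, 5, 6] : Fin 6 → Fin 8) a)
            ((![0, 1, 2, 4, 5, 6] : Fin 6 → Fin 8) b))
      - M 7 4 * pfa3 (fun a b : Fin 6 =>
          M ((![0, 1, 2, 3, 5, 6] : Fin 6 → Fin 8) a)
            ((![0, 1, 2, 3, 5, 6] : Fin 6 → Fin 8) b))
      + M 7 5 * pfa3 (fun a b : Fin 6 =>
          M ((![0, 1, 2, 3, 4, 6] : Fin 6 → Fin 8) a)
            ((![0, 1, 2, 3, 4, 6] : Fin 6 → Fin 8) b))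
      - M 7 6 * pfa3 (fun a b : Fin 6 =>
          M ((![0, 1, 2, 3, 4, 5] : Fin 6 → Fin 8) a)
            ((![0, 1, 2, 3, 4, 5] : Fin 6 → Fin 8) b)) := by
  have h : ∀ (j : Fin 7) (v : Fin 6 → Fin 8), (∀ a, (j.succAbove a).castSucc = v a) →
      (fun a b : Fin 6 => M ((j.succAbove a).castSucc) ((j.succAbove b).castSucc)) =
        fun a b => M (v a) (v b) := by
    intro j v hv
    funext a b
    rw [hv, hv]
  rw [← h 0 (![1, 2, 3, 4, 5, 6] : Fin 6 → Fin 8) (by decide)]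
  rw [← h 1 (![0, 2, 3, 4, 5, 6] : Fin 6 → Fin 8) (by decide)]
  rw [← h 2 (![0, 1, 3, 4, 5, 6] : Fin 6 → Fin 8) (by decide)]
  rw [← h 3 (![0, 1, 2, 4, 5, 6] : Fin 6 → Fin 8) (by decide)]
  rw [← h 4 (![0, 1, 2, 3, 5, 6] : Fin 6 → Fin 8) (by decide)]
  rw [← h 5 (![0, 1, 2, 3, 4, 6] : Fin 6 → Fin 8) (by decide)]
  rw [← h 6 (![0, 1, 2, 3, 4, 5] : Fin 6 → Fin 8) (by decide)]
  refine Eq.trans (show pfa4 M = ∑ j : Fin 7, (-1 : S) ^ ((j : ℕ) + 1) *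
      M (Fin.last 7) j.castSucc * pfa3 (fun a b : Fin 6 =>
        M ((j.succAbove a).castSucc) ((j.succAbove b).castSucc)) from rfl) ?_
  refine (Fin.sum_univ_seven _).trans ?_
  change (-1) ^ 1 * M 7 0 * pfa3 _ + (-1) ^ 2 * M 7 1 * pfa3 _ + (-1) ^ 3 * M 7 2 * pfa3 _ + (-1) ^ 4 * M 7 3 * pfa3 _ + (-1) ^ 5 * M 7 4 * pfa3 _ + (-1) ^ 6 * M 7 5 * pfa3 _ + (-1) ^ 7 * M 7 6 * pfa3 _ = _
  ring

theorem sum_univ_nine_aux {S : Type*} [CommRing S] (g : Fin 9 → S) :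
    ∑ i, g i = g 0 + g 1 + g 2 + g 3 + g 4 + g 5 + g 6 + g 7 + g 8 := by
  rw [Fin.sum_univ_castSucc, Fin.sum_univ_eight]
  rfl

theorem pf_step5 {S : Type*} [CommRing S] (M : Fin 10 → Fin 10 → S) :
    pfa5 M =
      - M 9 0 * pfa4 (fun a b : Fin 8 =>
          M ((![1, 2, 3, 4, 5, 6, 7, 8] : Fin 8 → Fin 10) a)
            ((![1, 2, 3, 4, 5, 6, 7, 8] : Fin 8 → Fin 10) b))
      + M 9 1 * pfa4 (fun a b : Fin 8 =>
          M ((![0, 2, 3, 4, 5, 6, 7, 8] : Fin 8 → Fin 10) a)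
            ((![0, 2, 3, 4, 5, 6, 7, 8] : Fin 8 → Fin 10) b))
      - M 9 2 * pfa4 (fun a b : Fin 8 =>
          M ((![0, 1, 3, 4, 5, 6, 7, 8] : Fin 8 → Fin 10) a)
            ((![0, 1, 3, 4, 5, 6, 7, 8] : Fin 8 → Fin 10) b))
      + M 9 3 * pfa4 (fun a b : Fin 8 =>
          M ((![0, 1, 2, 4, 5, 6, 7, 8] : Fin 8 → Fin 10) a)
            ((![0, 1, 2, 4, 5, 6, 7, 8] : Fin 8 → Fin 10) b))
      - M 9 4 * pfa4 (fun a b : Fin 8 =>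
          M ((![0, 1, 2, 3, 5, 6, 7, 8] : Fin 8 → Fin 10) a)
            ((![0, 1, 2, 3, 5, 6, 7, 8] : Fin 8 → Fin 10) b))
      + M 9 5 * pfa4 (fun a b : Fin 8 =>
          M ((![0, 1, 2, 3, 4, 6, 7, 8] : Fin 8 → Fin 10) a)
            ((![0, 1, 2, 3, 4, 6, 7, 8] : Fin 8 → Fin 10) b))
      - M 9 6 * pfa4 (fun a b : Fin 8 =>
          M ((![0, 1, 2, 3, 4, 5, 7, 8] : Fin 8 → Fin 10) a)
            ((![0, 1, 2, 3, 4, 5, 7, 8] : Fin 8 → Fin 10) b))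
      + M 9 7 * pfa4 (fun a b : Fin 8 =>
          M ((![0, 1, 2, 3, 4, 5, 6, 8] : Fin 8 → Fin 10) a)
            ((![0, 1, 2, 3, 4, 5, 6, 8] : Fin 8 → Fin 10) b))
      - M 9 8 * pfa4 (fun a b : Fin 8 =>
          M ((![0, 1, 2, 3, 4, 5, 6, 7] : Fin 8 → Fin 10) a)
            ((![0, 1, 2, 3, 4, 5, 6, 7] : Fin 8 → Fin 10) b)) := by
  have h : ∀ (j : Fin 9) (v : Fin 8 → Fin 10), (∀ a, (j.succAbove a).castSucc = v a) →
      (fun a b : Fin 8 => M ((j.succAbove a).castSucc) ((j.succAbove b).castSucc)) =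
        fun a b => M (v a) (v b) := by
    intro j v hv
    funext a b
    rw [hv, hv]
  rw [← h 0 (![1, 2, 3, 4, 5, 6, 7, 8] : Fin 8 → Fin 10) (by decide)]
  rw [← h 1 (![0, 2, 3, 4, 5, 6, 7, 8] : Fin 8 → Fin 10) (by decide)]
  rw [← h 2 (![0, 1, 3, 4, 5, 6, 7, 8] : Fin 8 → Fin 10) (by decide)]
  rw [← h 3 (![0, 1, 2, 4, 5, 6, 7, 8] : Fin 8 → Fin 10) (by decide)]
  rw [← h 4 (![0, 1, 2, 3, 5, 6, 7, 8] : Fin 8 → Fin 10) (by decide)]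
  rw [← h 5 (![0, 1, 2, 3, 4, 6, 7, 8] : Fin 8 → Fin 10) (by decide)]
  rw [← h 6 (![0, 1, 2, 3, 4, 5, 7, 8] : Fin 8 → Fin 10) (by decide)]
  rw [← h 7 (![0, 1, 2, 3, 4, 5, 6, 8] : Fin 8 → Fin 10) (by decide)]
  rw [← h 8 (![0, 1, 2, 3, 4, 5, 6, 7] : Fin 8 → Fin 10) (by decide)]
  refine Eq.trans (show pfa5 M = ∑ j : Fin 9, (-1 : S) ^ ((j : ℕ) + 1) *
      M (Fin.last 9) j.castSucc * pfa4 (fun a b : Fin 8 =>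
        M ((j.succAbove a).castSucc) ((j.succAbove b).castSucc)) from rfl) ?_
  refine (sum_univ_nine_aux _).trans ?_
  change (-1) ^ 1 * M 9 0 * pfa4 _ + (-1) ^ 2 * M 9 1 * pfa4 _ + (-1) ^ 3 * M 9 2 * pfa4 _ + (-1) ^ 4 * M 9 3 * pfa4 _ + (-1) ^ 5 * M 9 4 * pfa4 _ + (-1) ^ 6 * M 9 5 * pfa4 _ + (-1) ^ 7 * M 9 6 * pfa4 _ + (-1) ^ 8 * M 9 7 * pfa4 _ + (-1) ^ 9 * M 9 8 * pfa4 _ = _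
  ring

/-- The explicit template matrix. -/
def quinticMatrix {S : Type*} [CommRing S] (x y z t1 t2 t3 t4 t5 t6 t7 t8 t9 t10 t11 t12 t13 t14 t15 t16 t17 t18 t19 t20 t21 : S) : Matrix (Fin 10) (Fin 10) S :=
  !![0, t1*x + t4*y + t8*z, (-t18)*x + (-t12)*y + (-t13)*z, (-t2)*y, (-(2*t6+t21))*x + (-(2*t7+t20))*y, t9*z, -y, -z, 0, 0;
    -(t1*x + t4*y + t8*z), 0, t2*y, t6*x + t7*y, 0, (-t5)*y, -z, 0, 0, 0;
    -((-t18)*x + (-t12)*y + (-t13)*z), -(t2*y), 0, t3*z, (-t16)*x + (-t14)*y + (-t15)*z, 0, 0, 0, 0, x;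
    -((-t2)*y), -(t6*x + t7*y), -(t3*z), 0, (-t10)*x + (-t11)*z, t19*x + t17*y, 0, 0, x, -y;
    -((-(2*t6+t21))*x + (-(2*t7+t20))*y), 0, -((-t16)*x + (-t14)*y + (-t15)*z), -((-t10)*x + (-t11)*z), 0, (2*t2)*y, 0, x, -y, -z;
    -(t9*z), -((-t5)*y), 0, -(t19*x + t17*y), -((2*t2)*y), 0, x, y, -z, 0;
    -(-y), -(-z), 0, 0, 0, -(x), 0, 0, 0, 0;
    -(-z), 0, 0, 0, -(x), -(y), 0, 0, 0, 0;
    0, 0, 0, -(x), -(-y), -(-z), 0, 0, 0, 0;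
    0, 0, -(x), -(-y), -(-z), 0, 0, 0, 0, 0]

theorem quinticMatrix_pf {S : Type*} [CommRing S] (x y z t1 t2 t3 t4 t5 t6 t7 t8 t9 t10 t11 t12 t13 t14 t15 t16 t17 t18 t19 t20 t21 : S)
    (M : Fin 10 → Fin 10 → S) (hM : M = quinticMatrix x y z t1 t2 t3 t4 t5 t6 t7 t8 t9 t10 t11 t12 t13 t14 t15 t16 t17 t18 t19 t20 t21) :
    pfa5 M =
      x ^ 5 * t1 + y ^ 5 * t2 + z ^ 5 * t3 +
      x ^ 4 * y * t4 + x ^ 3 * y ^ 2 * t5 + x ^ 2 * y ^ 3 * t6 +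
      x * y ^ 4 * t7 + x ^ 4 * z * t8 + x ^ 3 * z ^ 2 * t9 +
      x ^ 2 * z ^ 3 * t10 + x * z ^ 4 * t11 +
      y ^ 4 * z * t12 + y ^ 3 * z ^ 2 * t13 + y ^ 2 * z ^ 3 * t14 +
      y * z ^ 4 * t15 + x * y * z ^ 3 * t16 + x * y ^ 2 * z ^ 2 * t17 +
      x * y ^ 3 * z * t18 + x ^ 2 * y * z ^ 2 * t19 +
      x ^ 2 * y ^ 2 * z * t20 + x ^ 3 * y * z * t21 := by
  have e10 : M 1 0 = -(t1*x + t4*y + t8*z) := by rw [hM]; rfl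
  have e20 : M 2 0 = -((-t18)*x + (-t12)*y + (-t13)*z) := by rw [hM]; rfl
  have e21 : M 2 1 = -(t2*y) := by rw [hM]; rfl
  have e30 : M 3 0 = -((-t2)*y) := by rw [hM]; rfl
  have e31 : M 3 1 = -(t6*x + t7*y) := by rw [hM]; rfl
  have e32 : M 3 2 = -(t3*z) := by rw [hM]; rfl
  have e40 : M 4 0 = -((-(2*t6+t21))*x + (-(2*t7+t20))*y) := by rw [hM]; rfl
  have e41 : M 4 1 = 0 := by rw [hM]; rfl
  have e42 : M 4 2 = -((-t16)*x + (-t14)*y + (-t15)*z) := by rw [hM]; rfl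
  have e43 : M 4 3 = -((-t10)*x + (-t11)*z) := by rw [hM]; rfl
  have e50 : M 5 0 = -(t9*z) := by rw [hM]; rfl
  have e51 : M 5 1 = -((-t5)*y) := by rw [hM]; rfl
  have e52 : M 5 2 = 0 := by rw [hM]; rfl
  have e53 : M 5 3 = -(t19*x + t17*y) := by rw [hM]; rfl
  have e54 : M 5 4 = -((2*t2)*y) := by rw [hM]; rfl
  have e60 : M 6 0 = -(-y) := by rw [hM]; rfl
  have e61 : M 6 1 = -(-z) := by rw [hM]; rfl
  have e62 : M 6 2 = 0 := by rw [hM]; rfl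
  have e63 : M 6 3 = 0 := by rw [hM]; rfl
  have e64 : M 6 4 = 0 := by rw [hM]; rfl
  have e65 : M 6 5 = -(x) := by rw [hM]; rfl
  have e70 : M 7 0 = -(-z) := by rw [hM]; rfl
  have e71 : M 7 1 = 0 := by rw [hM]; rfl
  have e72 : M 7 2 = 0 := by rw [hM]; rfl
  have e73 : M 7 3 = 0 := by rw [hM]; rfl
  have e74 : M 7 4 = -(x) := by rw [hM]; rfl
  have e75 : M 7 5 = -(y) := by rw [hM]; rfl
  have e76 : M 7 6 = 0 := by rw [hM]; rfl
  have e80 : M 8 0 = 0 := by rw [hM]; rfl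
  have e81 : M 8 1 = 0 := by rw [hM]; rfl
  have e82 : M 8 2 = 0 := by rw [hM]; rfl
  have e83 : M 8 3 = -(x) := by rw [hM]; rfl
  have e84 : M 8 4 = -(-y) := by rw [hM]; rfl
  have e85 : M 8 5 = -(-z) := by rw [hM]; rfl
  have e86 : M 8 6 = 0 := by rw [hM]; rfl
  have e87 : M 8 7 = 0 := by rw [hM]; rfl
  have e90 : M 9 0 = 0 := by rw [hM]; rfl
  have e91 : M 9 1 = 0 := by rw [hM]; rfl
  have e92 : M 9 2 = -(x) := by rw [hM]; rfl
  have e93 : M 9 3 = -(-y) := by rw [hM]; rfl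
  have e94 : M 9 4 = -(-z) := by rw [hM]; rfl
  have e95 : M 9 5 = 0 := by rw [hM]; rfl
  have e96 : M 9 6 = 0 := by rw [hM]; rfl
  have e97 : M 9 7 = 0 := by rw [hM]; rfl
  have e98 : M 9 8 = 0 := by rw [hM]; rfl
  clear hM
  simp only [pf_step5, e10, e20, e21, e30, e31, e32, e40, e41, e42, e43, e50, e51, e52, e53, e54, e60, e61, e62, e63, e64, e65, e70, e71, e72, e73, e74, e75, e76, e80, e81, e82, e83, e84, e85, e86, e87, e90, e91, e92, e93, e94, e95, e96, e97, e98, zero_mul, mul_zero, neg_zero, add_zero, zero_add, sub_zero, zero_sub]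
  simp only [pf_step4, Matrix.cons_val, e10, e20, e21, e30, e31, e32, e40, e41, e42, e43, e50, e51, e52, e53, e54, e60, e61, e62, e63, e64, e65, e70, e71, e72, e73, e74, e75, e76, e80, e81, e82, e83, e84, e85, e86, e87, e90, e91, e92, e93, e94, e95, e96, e97, e98, zero_mul, mul_zero, neg_zero, add_zero, zero_add, sub_zero, zero_sub]
  simp only [pf_step3, Matrix.cons_val, e10, e20, e21, e30, e31, e32, e40, e41, e42, e43, e50, e51, e52, e53, e54, e60, e61, e62, e63, e64, e65, e70, e71, e72, e73, e74, e75, e76, e80, e81, e82, e83, e84, e85, e86, e87, e90, e91, e92, e93, e94, e95, e96, e97, e98, zero_mul, mul_zero, neg_zero, add_zero, zero_add, sub_zero, zero_sub]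
  simp only [pf_two, Matrix.cons_val, e10, e20, e21, e30, e31, e32, e40, e41, e42, e43, e50, e51, e52, e53, e54, e60, e61, e62, e63, e64, e65, e70, e71, e72, e73, e74, e75, e76, e80, e81, e82, e83, e84, e85, e86, e87, e90, e91, e92, e93, e94, e95, e96, e97, e98, zero_mul, mul_zero, neg_zero, add_zero, zero_add, sub_zero, zero_sub]
  ring

theorem quinticMatrix_skew {S : Type*} [CommRing S] (x y z t1 t2 t3 t4 t5 t6 t7 t8 t9 t10 t11 t12 t13 t14 t15 t16 t17 t18 t19 t20 t21 : S) :
    (quinticMatrix x y z t1 t2 t3 t4 t5 t6 t7 t8 t9 t10 t11 t12 t13 t14 t15 t16 t17 t18 t19 t20 t21)ᵀ = -(quinticMatrix x y z t1 t2 t3 t4 t5 t6 t7 t8 t9 t10 t11 t12 t13 t14 t15 t16 t17 t18 t19 t20 t21) := by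
  ext i j
  rw [Matrix.transpose_apply, Matrix.neg_apply]
  fin_cases i <;> fin_cases j <;>
    first
    | exact neg_zero.symm
    | exact (neg_neg _).symm
    | rfl

theorem quinticMatrix_block {S : Type*} [CommRing S] (x y z t1 t2 t3 t4 t5 t6 t7 t8 t9 t10 t11 t12 t13 t14 t15 t16 t17 t18 t19 t20 t21 : S) (i j : Fin 10)
    (hi : 6 ≤ (i : ℕ)) (hij : (i : ℕ) < (j : ℕ)) :
    quinticMatrix x y z t1 t2 t3 t4 t5 t6 t7 t8 t9 t10 t11 t12 t13 t14 t15 t16 t17 t18 t19 t20 t21 i j = 0 := by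
  fin_cases i <;> fin_cases j <;>
    first
    | rfl
    | (exfalso; revert hi; decide)
    | (exfalso; revert hij; decide)

/-- Being an `R`-linear combination of the three variables. -/
def IsLin {R : Type*} [CommRing R] (p : MvPolynomial (Fin 3) R) : Prop :=
  ∃ a b c : R, p = C a * X 0 + C b * X 1 + C c * X 2

theorem IsLin.zero {R : Type*} [CommRing R] : IsLin (0 : MvPolynomial (Fin 3) R) :=
  ⟨0, 0, 0, by simp⟩

theorem IsLin.add {R : Type*} [CommRing R] {p q : MvPolynomial (Fin 3) R}
    (hp : IsLin p) (hq : IsLin q) : IsLin (p + q) := by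
  obtain ⟨a, b, c, rfl⟩ := hp
  obtain ⟨a', b', c', rfl⟩ := hq
  exact ⟨a + a', b + b', c + c', by simp only [map_add]; ring⟩

theorem IsLin.neg {R : Type*} [CommRing R] {p : MvPolynomial (Fin 3) R}
    (hp : IsLin p) : IsLin (-p) := by
  obtain ⟨a, b, c, rfl⟩ := hp
  exact ⟨-a, -b, -c, by simp only [map_neg]; ring⟩

theorem IsLin.var {R : Type*} [CommRing R] (i : Fin 3) :
    IsLin (X i : MvPolynomial (Fin 3) R) := by
  fin_cases i
  · exact ⟨1, 0, 0, by simp⟩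
  · exact ⟨0, 1, 0, by simp⟩
  · exact ⟨0, 0, 1, by simp⟩

theorem IsLin.smul {R : Type*} [CommRing R] (r : R) {p : MvPolynomial (Fin 3) R}
    (hp : IsLin p) : IsLin (C r * p) := by
  obtain ⟨a, b, c, rfl⟩ := hp
  exact ⟨r * a, r * b, r * c, by simp only [map_mul]; ring⟩

theorem IsLin.smul_neg {R : Type*} [CommRing R] (r : R) {p : MvPolynomial (Fin 3) R}
    (hp : IsLin p) : IsLin (-C r * p) := by
  rw [← C_neg]
  exact hp.smul _

theorem IsLin.smul_two {R : Type*} [CommRing R] (r : R) {p : MvPolynomial (Fin 3) R}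
    (hp : IsLin p) : IsLin (2 * C r * p) := by
  rw [two_mul, ← C_add]
  exact hp.smul _

theorem IsLin.smul_big {R : Type*} [CommRing R] (r s : R) {p : MvPolynomial (Fin 3) R}
    (hp : IsLin p) : IsLin (-(2 * C r + C s) * p) := by
  rw [two_mul, ← C_add, ← C_add]
  exact hp.smul_neg _

theorem quinticMatrix_linear {R : Type*} [CommRing R] (Θ₁ Θ₂ Θ₃ Θ₄ Θ₅ Θ₆ Θ₇ Θ₈ Θ₉ Θ₁₀ Θ₁₁ Θ₁₂ Θ₁₃ Θ₁₄ Θ₁₅ Θ₁₆ Θ₁₇ Θ₁₈ Θ₁₉ Θ₂₀ Θ₂₁ : R) (i j : Fin 10) :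
    IsLin (quinticMatrix (X 0) (X 1) (X 2) (C Θ₁) (C Θ₂) (C Θ₃) (C Θ₄) (C Θ₅) (C Θ₆) (C Θ₇) (C Θ₈) (C Θ₉) (C Θ₁₀) (C Θ₁₁) (C Θ₁₂) (C Θ₁₃) (C Θ₁₄) (C Θ₁₅) (C Θ₁₆) (C Θ₁₇) (C Θ₁₈) (C Θ₁₉) (C Θ₂₀) (C Θ₂₁) i j) := by
  fin_cases i <;> fin_cases j
  · exact IsLin.zero
  · exact (((IsLin.var 0).smul Θ₁).add ((IsLin.var 1).smul Θ₄)).add ((IsLin.var 2).smul Θ₈)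
  · exact (((IsLin.var 0).smul_neg Θ₁₈).add ((IsLin.var 1).smul_neg Θ₁₂)).add ((IsLin.var 2).smul_neg Θ₁₃)
  · exact (IsLin.var 1).smul_neg Θ₂
  · exact ((IsLin.var 0).smul_big Θ₆ Θ₂₁).add ((IsLin.var 1).smul_big Θ₇ Θ₂₀)
  · exact (IsLin.var 2).smul Θ₉
  · exact (IsLin.var 1).neg
  · exact (IsLin.var 2).neg
  · exact IsLin.zero
  · exact IsLin.zero
  · exact ((((IsLin.var 0).smul Θ₁).add ((IsLin.var 1).smul Θ₄)).add ((IsLin.var 2).smul Θ₈)).neg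
  · exact IsLin.zero
  · exact (IsLin.var 1).smul Θ₂
  · exact ((IsLin.var 0).smul Θ₆).add ((IsLin.var 1).smul Θ₇)
  · exact IsLin.zero
  · exact (IsLin.var 1).smul_neg Θ₅
  · exact (IsLin.var 2).neg
  · exact IsLin.zero
  · exact IsLin.zero
  · exact IsLin.zero
  · exact ((((IsLin.var 0).smul_neg Θ₁₈).add ((IsLin.var 1).smul_neg Θ₁₂)).add ((IsLin.var 2).smul_neg Θ₁₃)).neg
  · exact ((IsLin.var 1).smul Θ₂).neg
  · exact IsLin.zero
  · exact (IsLin.var 2).smul Θ₃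
  · exact (((IsLin.var 0).smul_neg Θ₁₆).add ((IsLin.var 1).smul_neg Θ₁₄)).add ((IsLin.var 2).smul_neg Θ₁₅)
  · exact IsLin.zero
  · exact IsLin.zero
  · exact IsLin.zero
  · exact IsLin.zero
  · exact (IsLin.var 0)
  · exact ((IsLin.var 1).smul_neg Θ₂).neg
  · exact (((IsLin.var 0).smul Θ₆).add ((IsLin.var 1).smul Θ₇)).neg
  · exact ((IsLin.var 2).smul Θ₃).neg
  · exact IsLin.zero
  · exact ((IsLin.var 0).smul_neg Θ₁₀).add ((IsLin.var 2).smul_neg Θ₁₁)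
  · exact ((IsLin.var 0).smul Θ₁₉).add ((IsLin.var 1).smul Θ₁₇)
  · exact IsLin.zero
  · exact IsLin.zero
  · exact (IsLin.var 0)
  · exact (IsLin.var 1).neg
  · exact (((IsLin.var 0).smul_big Θ₆ Θ₂₁).add ((IsLin.var 1).smul_big Θ₇ Θ₂₀)).neg
  · exact IsLin.zero
  · exact ((((IsLin.var 0).smul_neg Θ₁₆).add ((IsLin.var 1).smul_neg Θ₁₄)).add ((IsLin.var 2).smul_neg Θ₁₅)).neg
  · exact (((IsLin.var 0).smul_neg Θ₁₀).add ((IsLin.var 2).smul_neg Θ₁₁)).neg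
  · exact IsLin.zero
  · exact (IsLin.var 1).smul_two Θ₂
  · exact IsLin.zero
  · exact (IsLin.var 0)
  · exact (IsLin.var 1).neg
  · exact (IsLin.var 2).neg
  · exact ((IsLin.var 2).smul Θ₉).neg
  · exact ((IsLin.var 1).smul_neg Θ₅).neg
  · exact IsLin.zero
  · exact (((IsLin.var 0).smul Θ₁₉).add ((IsLin.var 1).smul Θ₁₇)).neg
  · exact ((IsLin.var 1).smul_two Θ₂).neg
  · exact IsLin.zero
  · exact (IsLin.var 0)
  · exact (IsLin.var 1)
  · exact (IsLin.var 2).neg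
  · exact IsLin.zero
  · exact ((IsLin.var 1).neg).neg
  · exact ((IsLin.var 2).neg).neg
  · exact IsLin.zero
  · exact IsLin.zero
  · exact IsLin.zero
  · exact ((IsLin.var 0)).neg
  · exact IsLin.zero
  · exact IsLin.zero
  · exact IsLin.zero
  · exact IsLin.zero
  · exact ((IsLin.var 2).neg).neg
  · exact IsLin.zero
  · exact IsLin.zero
  · exact IsLin.zero
  · exact ((IsLin.var 0)).neg
  · exact ((IsLin.var 1)).neg
  · exact IsLin.zero
  · exact IsLin.zero
  · exact IsLin.zero
  · exact IsLin.zero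
  · exact IsLin.zero
  · exact IsLin.zero
  · exact IsLin.zero
  · exact ((IsLin.var 0)).neg
  · exact ((IsLin.var 1).neg).neg
  · exact ((IsLin.var 2).neg).neg
  · exact IsLin.zero
  · exact IsLin.zero
  · exact IsLin.zero
  · exact IsLin.zero
  · exact IsLin.zero
  · exact IsLin.zero
  · exact ((IsLin.var 0)).neg
  · exact ((IsLin.var 1).neg).neg
  · exact ((IsLin.var 2).neg).neg
  · exact IsLin.zero
  · exact IsLin.zero
  · exact IsLin.zero
  · exact IsLin.zero
  · exact IsLin.zero
/-- Every ternary quintic `f = x⁵Θ₁ + y⁵Θ₂ + z⁵Θ₃ + …` over a commutative ring `R` is the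
Pfaffian of a `10 × 10` skew-symmetric matrix `M` of linear forms having the shape of
Example 2.3. Here `x = X 0`, `y = X 1`, `z = X 2`, and indices are 0-based. -/
theorem ternary_quintic_admits_pfaffian_representation_of_template_shape
    {R : Type*} [CommRing R]
    (Θ₁ Θ₂ Θ₃ Θ₄ Θ₅ Θ₆ Θ₇ Θ₈ Θ₉ Θ₁₀ Θ₁₁ Θ₁₂ Θ₁₃ Θ₁₄ Θ₁₅ Θ₁₆ Θ₁₇ Θ₁₈ Θ₁₉ Θ₂₀ Θ₂₁ : R)
    (f : MvPolynomial (Fin 3) R)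
    (hf : f =
      X 0 ^ 5 * C Θ₁ + X 1 ^ 5 * C Θ₂ + X 2 ^ 5 * C Θ₃ +
      X 0 ^ 4 * X 1 * C Θ₄ + X 0 ^ 3 * X 1 ^ 2 * C Θ₅ + X 0 ^ 2 * X 1 ^ 3 * C Θ₆ +
      X 0 * X 1 ^ 4 * C Θ₇ + X 0 ^ 4 * X 2 * C Θ₈ + X 0 ^ 3 * X 2 ^ 2 * C Θ₉ +
      X 0 ^ 2 * X 2 ^ 3 * C Θ₁₀ + X 0 * X 2 ^ 4 * C Θ₁₁ +
      X 1 ^ 4 * X 2 * C Θ₁₂ + X 1 ^ 3 * X 2 ^ 2 * C Θ₁₃ + X 1 ^ 2 * X 2 ^ 3 * C Θ₁₄ +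
      X 1 * X 2 ^ 4 * C Θ₁₅ + X 0 * X 1 * X 2 ^ 3 * C Θ₁₆ + X 0 * X 1 ^ 2 * X 2 ^ 2 * C Θ₁₇ +
      X 0 * X 1 ^ 3 * X 2 * C Θ₁₈ + X 0 ^ 2 * X 1 * X 2 ^ 2 * C Θ₁₉ +
      X 0 ^ 2 * X 1 ^ 2 * X 2 * C Θ₂₀ + X 0 ^ 3 * X 1 * X 2 * C Θ₂₁) :
    ∃ M : Matrix (Fin (2 * 5)) (Fin (2 * 5)) (MvPolynomial (Fin 3) R),
      Mᵀ = -M ∧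
      (∀ i j, ∃ a b c : R, M i j = C a * X 0 + C b * X 1 + C c * X 2) ∧
      matrixPfaffian 5 M = f ∧
      (M 0 1).coeff (Finsupp.single 0 1) = Θ₁ ∧
      (M 1 2).coeff (Finsupp.single 1 1) = Θ₂ ∧
      (M 2 3).coeff (Finsupp.single 2 1) = Θ₃ ∧
      M 0 6 = -X 1 ∧ M 0 7 = -X 2 ∧ M 0 8 = 0 ∧ M 0 9 = 0 ∧
      M 1 6 = -X 2 ∧ M 1 7 = 0 ∧ M 1 8 = 0 ∧ M 1 9 = 0 ∧
      M 2 6 = 0 ∧ M 2 7 = 0 ∧ M 2 8 = 0 ∧ M 2 9 = X 0 ∧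
      M 3 6 = 0 ∧ M 3 7 = 0 ∧ M 3 8 = X 0 ∧ M 3 9 = -X 1 ∧
      M 4 6 = 0 ∧ M 4 7 = X 0 ∧ M 4 8 = -X 1 ∧ M 4 9 = -X 2 ∧
      M 5 6 = X 0 ∧ M 5 7 = X 1 ∧ M 5 8 = -X 2 ∧ M 5 9 = 0 ∧
      (∀ i j : Fin (2 * 5), 6 ≤ (i : ℕ) → (i : ℕ) < (j : ℕ) → M i j = 0) := by
  refine ⟨quinticMatrix (X 0) (X 1) (X 2) (C Θ₁) (C Θ₂) (C Θ₃) (C Θ₄) (C Θ₅) (C Θ₆) (C Θ₇) (C Θ₈) (C Θ₉) (C Θ₁₀) (C Θ₁₁) (C Θ₁₂) (C Θ₁₃) (C Θ₁₄) (C Θ₁₅) (C Θ₁₆) (C Θ₁₇) (C Θ₁₈) (C Θ₁₉) (C Θ₂₀) (C Θ₂₁), ?_, ?_, ?_, ?_, ?_, ?_,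
    rfl, rfl, rfl, rfl, rfl, rfl, rfl, rfl, rfl, rfl, rfl, rfl,
    rfl, rfl, rfl, rfl, rfl, rfl, rfl, rfl, rfl, rfl, rfl, rfl, ?_⟩
  · exact quinticMatrix_skew ..
  · exact quinticMatrix_linear Θ₁ Θ₂ Θ₃ Θ₄ Θ₅ Θ₆ Θ₇ Θ₈ Θ₉ Θ₁₀ Θ₁₁ Θ₁₂ Θ₁₃ Θ₁₄ Θ₁₅ Θ₁₆ Θ₁₇ Θ₁₈ Θ₁₉ Θ₂₀ Θ₂₁
  · rw [hf]
    exact quinticMatrix_pf _ _ _ _ _ _ _ _ _ _ _ _ _ _ _ _ _ _ _ _ _ _ _ _ _ rfl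
  · change (C Θ₁ * X 0 + C Θ₄ * X 1 + C Θ₈ * X 2 : MvPolynomial (Fin 3) R).coeff _ = _
    simp [coeff_C_mul, coeff_X', Finsupp.single_left_inj]
  · change (C Θ₂ * X 1 : MvPolynomial (Fin 3) R).coeff _ = _
    simp [coeff_C_mul, coeff_X']
  · change (C Θ₃ * X 2 : MvPolynomial (Fin 3) R).coeff _ = _
    simp [coeff_C_mul, coeff_X']
  · intro i j hi hij
    exact quinticMatrix_block _ _ _ _ _ _ _ _ _ _ _ _ _ _ _ _ _ _ _ _ _ _ _ _ i j hi hij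
end

section
/- Let R be a commutative ring with 1. Then for every homogeneous polynomial f ∈ R[X₀,X₁,X₂] of degree 5 there exist 10×10 skew-symmetric matrices A₀, A₁, A₂ with entries in R such that det(X₀·A₀ + X₁·A₁ + X₂·A₂) = f(X₀,X₁,X₂)², where the determinant is taken of the matrix with entries in the polynomial ring R[X₀,X₁,X₂]. -/
open MvPolynomial Matrix

/-- The exponents of the 15 quartic monomials in three variables. -/
def quarticExp : Fin 15 → Fin 3 → ℕ :=
  ![![4, 0, 0], ![3, 1, 0], ![3, 0, 1], ![2, 2, 0], ![2, 1, 1], ![2, 0, 2], ![1, 3, 0], ![1, 2, 1], ![1, 1, 2], ![1, 0, 3], ![0, 4, 0], ![0, 3, 1], ![0, 2, 2], ![0, 1, 3], ![0, 0, 4]]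

/-- A `10 × 10` skew matrix whose Pfaffian is `∑ lₖ mₖ` with `mₖ` the quartic monomials. -/
def quinticMat {S : Type*} [CommRing S] (x y z : S) (l : Fin 15 → S) :
    Matrix (Fin 10) (Fin 10) S :=
  !![0, l 14, -l 13, l 12, -l 11, l 10, x, 0, 0, 0;
     -l 14, 0, l 9 + l 12, -l 8 - 2 * l 11, l 7 + 3 * l 10, -l 6, y, x, 0, 0;
     l 13, -l 9 - l 12, 0, l 5 + l 7 + 2 * l 10, -l 4 - 2 * l 6, l 3, z, y, x, 0;
     -l 12, l 8 + 2 * l 11, -l 5 - l 7 - 2 * l 10, 0, l 2 + l 3, -l 1, 0, z, y, x;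
     l 11, -l 7 - 3 * l 10, l 4 + 2 * l 6, -l 2 - l 3, 0, l 0, 0, 0, z, y;
     -l 10, l 6, -l 3, l 1, -l 0, 0, 0, 0, 0, z;
     -x, -y, -z, 0, 0, 0, 0, 0, 0, 0;
     0, -x, -y, -z, 0, 0, 0, 0, 0, 0;
     0, 0, -x, -y, -z, 0, 0, 0, 0, 0;
     0, 0, 0, -x, -y, -z, 0, 0, 0, 0]

/-- Row operations (determinant `x ^ 8`). -/
def quinticU {S : Type*} [CommRing S] (x y z : S) : Matrix (Fin 10) (Fin 10) S :=
  !![1, 0, 0, 0, 0, 0, 0, 0, 0, 0;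
     0, 1, 0, 0, 0, 0, 0, 0, 0, 0;
     0, 0, 1, 0, 0, 0, 0, 0, 0, 0;
     0, 0, 0, 1, 0, 0, 0, 0, 0, 0;
     x^2 * z^2 - 3 * x * y^2 * z + y^4, 2 * x^2 * y * z - x * y^3, -x^3 * z + x^2 * y^2, -x^3 * y, x^4, 0, 0, 0, 0, 0;
     -2 * x * y * z^2 + y^3 * z, x^2 * z^2 - x * y^2 * z, x^2 * y * z, -x^3 * z, 0, x^4, 0, 0, 0, 0;
     0, 0, 0, 0, 0, 0, 1, 0, 0, 0;
     0, 0, 0, 0, 0, 0, 0, 1, 0, 0;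
     0, 0, 0, 0, 0, 0, 0, 0, 1, 0;
     0, 0, 0, 0, 0, 0, 0, 0, 0, 1]

/-- The Pfaffian. -/
def quinticPf {S : Type*} [CommRing S] (x y z : S) (l : Fin 15 → S) : S :=
  l 0 * (x^4) + l 1 * (x^3 * y^1) + l 2 * (x^3 * z^1) + l 3 * (x^2 * y^2) + l 4 * (x^2 * y^1 * z^1) + l 5 * (x^2 * z^2) + l 6 * (x^1 * y^3) + l 7 * (x^1 * y^2 * z^1) + l 8 * (x^1 * y^1 * z^2) + l 9 * (x^1 * z^3) + l 10 * (y^4) + l 11 * (y^3 * z^1) + l 12 * (y^2 * z^2) + l 13 * (y^1 * z^3) + l 14 * (z^4)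

def rowPerm : Equiv.Perm (Fin 10) :=
  ⟨![9, 8, 7, 6, 4, 5, 0, 1, 2, 3], ![6, 7, 8, 9, 4, 5, 3, 2, 1, 0], by decide, by decide⟩

def colPerm : Equiv.Perm (Fin 10) :=
  ⟨![3, 2, 1, 0, 5, 4, 6, 7, 8, 9], ![3, 2, 1, 0, 5, 4, 6, 7, 8, 9], by decide, by decide⟩

lemma rowPerm_sign : Equiv.Perm.sign rowPerm = 1 := by
  have h : rowPerm = Equiv.swap 0 9 * Equiv.swap 9 3 * Equiv.swap 3 6 *
      (Equiv.swap 1 8 * Equiv.swap 8 2 * Equiv.swap 2 7) := by decide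
  rw [h]
  simp only [Equiv.Perm.sign_mul]
  repeat rw [Equiv.Perm.sign_swap (by decide)]
  rfl

lemma colPerm_sign : Equiv.Perm.sign colPerm = -1 := by
  have h : colPerm = Equiv.swap 0 3 * Equiv.swap 1 2 * Equiv.swap 4 5 := by decide
  rw [h]
  simp only [Equiv.Perm.sign_mul]
  repeat rw [Equiv.Perm.sign_swap (by decide)]
  rfl

lemma quinticU_det {S : Type*} [CommRing S] (x y z : S) : (quinticU x y z).det = x ^ 8 := by
  rw [Matrix.det_of_isLowerTriangular]
  · simp [quinticU, Fin.prod_univ_succ]; ring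
  · intro i j h
    simp only [OrderDual.toDual_lt_toDual] at h
    fin_cases i <;> fin_cases j <;> first | rfl | (exact absurd h (by decide))

lemma quinticMat_skew {S : Type*} [CommRing S] (x y z : S) (l : Fin 15 → S) :
    (quinticMat x y z l)ᵀ = -quinticMat x y z l := by
  ext i j
  rw [Matrix.transpose_apply, Matrix.neg_apply]
  fin_cases i <;> fin_cases j <;> (simp [quinticMat] <;> ring)

lemma quintic_entry {S : Type*} [CommRing S] (x y z : S) (l : Fin 15 → S) (i j : Fin 10) :
    (((quinticU x y z * quinticMat x y z l * (quinticU x y z)ᵀ).submatrix rowPerm id).submatrix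
      id colPerm) i j = ∑ a, (∑ b, quinticU x y z (![9, 8, 7, 6, 4, 5, 0, 1, 2, 3] i) b *
        quinticMat x y z l b a) * quinticU x y z (![3, 2, 1, 0, 5, 4, 6, 7, 8, 9] j) a := by
  simp only [Matrix.submatrix_apply, Matrix.mul_apply, Matrix.transpose_apply]
  rfl

set_option maxHeartbeats 4000000 in
lemma quintic_tri {S : Type*} [CommRing S] (x y z : S) (l : Fin 15 → S) :
    (((quinticU x y z * quinticMat x y z l * (quinticU x y z)ᵀ).submatrix rowPerm id).submatrix
      id colPerm).det = - x ^ 8 * (x ^ 4 * quinticPf x y z l) ^ 2 := by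
  rw [Matrix.det_of_isLowerTriangular]
  · simp only [quintic_entry, Fin.prod_univ_succ]
    simp [quinticU, quinticMat, quinticPf, Fin.sum_univ_succ]
    ring
  · intro i j h
    simp only [OrderDual.toDual_lt_toDual] at h
    rw [quintic_entry]
    fin_cases i <;> fin_cases j <;> first
      | (exact absurd h (by decide))
      | (simp [quinticU, quinticMat, Fin.sum_univ_succ]; done)
      | (simp [quinticU, quinticMat, Fin.sum_univ_succ]; ring1)

lemma quinticMat_det {S : Type*} [CommRing S] (x y z : S) (hx : IsRegular x) (l : Fin 15 → S) :
    (quinticMat x y z l).det = quinticPf x y z l ^ 2 := by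
  have h := quintic_tri x y z l
  rw [Matrix.det_permute', Matrix.det_permute, rowPerm_sign, colPerm_sign, Matrix.det_mul,
    Matrix.det_mul, Matrix.det_transpose, quinticU_det] at h
  apply (hx.left.pow 16)
  push_cast at h
  linear_combination -h

lemma quinticPf_eq {S : Type*} [CommRing S] (v : Fin 3 → S) (l : Fin 15 → S) :
    quinticPf (v 0) (v 1) (v 2) l = ∑ k, l k * ∏ i, v i ^ quarticExp k i := by
  simp [quinticPf, quarticExp, Fin.sum_univ_succ, Fin.prod_univ_succ]
  ring

lemma exp_split (a b c : ℕ) (h : a + b + c = 5) :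
    ∃ (k : Fin 15) (v : Fin 3), ∀ i, ![a, b, c] i = quarticExp k i + (if i = v then 1 else 0) := by
  have ha : a ≤ 5 := by omega
  have hb : b ≤ 5 := by omega
  obtain rfl : c = 5 - a - b := by omega
  interval_cases a <;> interval_cases b <;> first | omega | decide

/-- The parametrisation of quintics by 15 linear forms. -/
noncomputable def quinticT (R : Type*) [CommRing R] :
    (Fin 15 → Fin 3 → R) →ₗ[R] MvPolynomial (Fin 3) R where
  toFun l := ∑ k, (∑ v, X v * C (l k v)) * ∏ i, (X i : MvPolynomial (Fin 3) R) ^ quarticExp k i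
  map_add' l l' := by
    simp only [Pi.add_apply, C_add, mul_add, Finset.sum_add_distrib, add_mul]
  map_smul' r l := by
    simp only [Pi.smul_apply, smul_eq_mul, C_mul, RingHom.id_apply, MvPolynomial.smul_eq_C_mul,
      Finset.mul_sum, Finset.sum_mul]
    refine Finset.sum_congr rfl fun k _ => Finset.sum_congr rfl fun v _ => ?_
    ring

lemma quinticT_apply {R : Type*} [CommRing R] (l : Fin 15 → Fin 3 → R) : quinticT R l =
    ∑ k, (∑ v, X v * C (l k v)) * ∏ i, (X i : MvPolynomial (Fin 3) R) ^ quarticExp k i := rfl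

lemma quintic_mem {R : Type*} [CommRing R]
    (f : MvPolynomial (Fin 3) R) (hf : f.IsHomogeneous 5) : f ∈ LinearMap.range (quinticT R) := by
  rw [f.as_sum]
  refine Submodule.sum_mem _ fun d hd => ?_
  have h5 : d 0 + d 1 + d 2 = 5 := by
    have := hf (mem_support_iff.mp hd)
    rw [Finsupp.weight_apply, Finsupp.sum_fintype _ _ (by simp)] at this
    simpa [Fin.sum_univ_succ, add_assoc] using this
  obtain ⟨k, v, hkv⟩ := exp_split _ _ _ h5
  refine ⟨Pi.single k (Pi.single v (coeff d f)), ?_⟩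
  have hd' : ∀ i, d i = quarticExp k i + (if i = v then 1 else 0) := by
    intro i
    rw [← hkv i]
    fin_cases i <;> rfl
  have e1 : quinticT R (Pi.single k (Pi.single v (coeff d f)))
      = (X v * C (coeff d f)) * ∏ i, (X i : MvPolynomial (Fin 3) R) ^ quarticExp k i := by
    rw [quinticT_apply, Finset.sum_eq_single k, Finset.sum_eq_single v]
    · rw [Pi.single_eq_same, Pi.single_eq_same]
    · intro b _ hb
      rw [Pi.single_eq_same, Pi.single_eq_of_ne hb, C_0, mul_zero]
    · exact fun h => absurd (Finset.mem_univ _) h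
    · intro b _ hb
      rw [Pi.single_eq_of_ne hb]
      simp only [Pi.zero_apply, C_0, mul_zero, Finset.sum_const_zero, zero_mul]
    · exact fun h => absurd (Finset.mem_univ _) h
  rw [e1, monomial_eq, Finsupp.prod_fintype _ _ (by simp)]
  simp only [hd', pow_add, Finset.prod_mul_distrib]
  simp [pow_ite]
  ring

set_option maxHeartbeats 4000000 in
/-- Every homogeneous quintic `f ∈ R[X₀,X₁,X₂]` over a commutative ring `R` admits
`10 × 10` skew-symmetric matrices `A₀, A₁, A₂` over `R` with
`det(X₀·A₀ + X₁·A₁ + X₂·A₂) = f²`. -/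
theorem every_ternary_quintic_admits_linear_determinantal_pfaffian_representation
    {R : Type*} [CommRing R]
    (f : MvPolynomial (Fin 3) R) (hf : f.IsHomogeneous 5) :
    ∃ A₀ A₁ A₂ : Matrix (Fin 10) (Fin 10) R,
      A₀ᵀ = -A₀ ∧ A₁ᵀ = -A₁ ∧ A₂ᵀ = -A₂ ∧
      ((X 0 : MvPolynomial (Fin 3) R) • A₀.map C + (X 1 : MvPolynomial (Fin 3) R) • A₁.map C +
          (X 2 : MvPolynomial (Fin 3) R) • A₂.map C :
        Matrix (Fin 10) (Fin 10) (MvPolynomial (Fin 3) R)).det = f ^ 2 := by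
  obtain ⟨l, rfl⟩ := quintic_mem f hf
  refine ⟨quinticMat 1 0 0 (fun k => l k 0), quinticMat 0 1 0 (fun k => l k 1),
    quinticMat 0 0 1 (fun k => l k 2), quinticMat_skew _ _ _ _, quinticMat_skew _ _ _ _,
    quinticMat_skew _ _ _ _, ?_⟩
  have c2 : (C 2 : MvPolynomial (Fin 3) R) = 2 := map_ofNat C 2
  have c3 : (C 3 : MvPolynomial (Fin 3) R) = 3 := map_ofNat C 3
  have hM : ((X 0 : MvPolynomial (Fin 3) R) • (quinticMat 1 0 0 (fun k => l k 0)).map C +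
      (X 1 : MvPolynomial (Fin 3) R) • (quinticMat 0 1 0 (fun k => l k 1)).map C +
      (X 2 : MvPolynomial (Fin 3) R) • (quinticMat 0 0 1 (fun k => l k 2)).map C :
        Matrix (Fin 10) (Fin 10) (MvPolynomial (Fin 3) R)) =
      quinticMat (X 0) (X 1) (X 2) (fun k => ∑ v, X v * C (l k v)) := by
    have e : ∀ k, (∑ v, X v * C (l k v) : MvPolynomial (Fin 3) R) =
        X 0 * C (l k 0) + X 1 * C (l k 1) + X 2 * C (l k 2) := fun k => Fin.sum_univ_three _
    simp only [e]
    ext1 i j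
    simp only [Matrix.add_apply, Matrix.smul_apply, Matrix.map_apply, smul_eq_mul]
    fin_cases i <;> fin_cases j <;> (simp [quinticMat, c2, c3] <;> ring)
  rw [hM, quinticMat_det _ _ _ isRegular_X, quinticPf_eq X, quinticT_apply]
end
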